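/- Let f ∈ W^{2,∞}(ℝ/ℤ) be a closed curve in ℝⁿ satisfying the bi-Lipschitz condition, and for each m let 0 ≤ θ₁ < … < θ_m < 1 satisfy the equilateral condition. With g_{ij,d} = ‖Δᵢf‖‖Δⱼf‖, g_{ij,n} = ‖Δᵢʲf‖‖Δ_{i+1}^{j+1}f‖, ḡ_{ij,n} = ‖Δᵢʲf‖², define P_{ij} = (g_{ij,d}/ḡ_{ij,n})·[ 1 − (1/(2g_{ij,d}))·( ΔᵢΔⱼḡ_{ij,n} + 4(Δᵢʲf·Δᵢf)(Δᵢʲf·Δⱼf)/ḡ_{ij,n} ) ], M_{ij} = (g_{ij,d}/g_{ij,n})·[ 1 − ½ΔᵢΔⱼ(g_{ij,n}/g_{ij,d}) + (g_{ij,d}/(2g_{ij,n}))·( (Δᵢ(g_{ij,n}/g_{ij,d}))(Δⱼ(g_{ij,n}/g_{ij,d})) − 1 ) ], and R_{ij} = M_{ij} − P_{ij}. Then lim_{m→∞} Σ_{i≠j (mod m)} P_{ij} = E(f) − 4 and lim_{m→∞} Σ_{i≠j (mod m)} R_{ij} = 0. -/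

import Mathlib

open MeasureTheory Real
open scoped RealInnerProductSpace ENNReal

noncomputable section

/-- The standard distance on `ℝ/ℤ`, expressed through real representatives. -/
def circleDist (a b : ℝ) : ℝ := min (Int.fract (a - b)) (1 - Int.fract (a - b))

/-- The `H^{1/2}`-seminorm `[u]_{H^{1/2}(I×J)}`. -/
def seminormH {n : ℕ} (u : ℝ → EuclideanSpace ℝ (Fin n)) (I J : Set ℝ) : ℝ :=
  Real.sqrt (∫ a in I, ∫ b in J, ‖u a - u b‖ ^ 2 / circleDist a b ^ 2)

/-- `K(u, ε)`: supremum of the `H^{1/2}`-seminorms of `u` over pairs of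
measurable subsets of `ℝ/ℤ` of measure at most `ε`. -/
def Kmod {n : ℕ} (u : ℝ → EuclideanSpace ℝ (Fin n)) (ε : ℝ) : ℝ :=
  sSup { r : ℝ | ∃ I J : Set ℝ, MeasurableSet I ∧ MeasurableSet J ∧
    I ⊆ Set.Ico (0 : ℝ) 1 ∧ J ⊆ Set.Ico (0 : ℝ) 1 ∧
    volume I ≤ ENNReal.ofReal ε ∧ volume J ≤ ENNReal.ofReal ε ∧
    r = seminormH u I J }

/-- Difference operator `Δᵢ` in the first index. -/
def dOpI (u : ℤ → ℤ → ℝ) (i j : ℤ) : ℝ := u (i + 1) j - u i j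

/-- Difference operator `Δⱼ` in the second index. -/
def dOpJ (u : ℤ → ℤ → ℝ) (i j : ℤ) : ℝ := u i (j + 1) - u i j

/-- Arithmetic mean `Aᵢ` in the first index. -/
def aOpI (u : ℤ → ℤ → ℝ) (i j : ℤ) : ℝ := (u i j + u (i + 1) j) / 2

/-- Arithmetic mean `Aⱼ` in the second index. -/
def aOpJ (u : ℤ → ℤ → ℝ) (i j : ℤ) : ℝ := (u i j + u i (j + 1)) / 2

/-- Arithmetic mean `A_{ij}` over the four corners. -/
def aOpIJ (u : ℤ → ℤ → ℝ) (i j : ℤ) : ℝ :=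
  (u i j + u (i + 1) j + u i (j + 1) + u (i + 1) (j + 1)) / 4

/-- The chord `Δᵢʲf = f(θⱼ) − f(θᵢ)`. -/
def chord {n : ℕ} (f : ℝ → EuclideanSpace ℝ (Fin n)) (θ : ℤ → ℝ) (i j : ℤ) :
    EuclideanSpace ℝ (Fin n) := f (θ j) - f (θ i)

/-- The edge `Δᵢf = f(θᵢ₊₁) − f(θᵢ)`. -/
def edge {n : ℕ} (f : ℝ → EuclideanSpace ℝ (Fin n)) (θ : ℤ → ℝ) (i : ℤ) :
    EuclideanSpace ℝ (Fin n) := f (θ (i + 1)) - f (θ i)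

/-- The unit edge vector `Δᵢf/‖Δᵢf‖`. -/
def uedge {n : ℕ} (f : ℝ → EuclideanSpace ℝ (Fin n)) (θ : ℤ → ℝ) (i : ℤ) :
    EuclideanSpace ℝ (Fin n) := ‖edge f θ i‖⁻¹ • edge f θ i

/-- Chord length `‖Δᵢʲf‖` as a doubly indexed quantity. -/
def chn {n : ℕ} (f : ℝ → EuclideanSpace ℝ (Fin n)) (θ : ℤ → ℝ) (i j : ℤ) : ℝ :=
  ‖chord f θ i j‖


/-- Sum of `F i j` over ordered pairs of distinct residues mod `m`,
represented by indices in `{1, …, m}`. -/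
def discSum (m : ℕ) (F : ℤ → ℤ → ℝ) : ℝ :=
  ∑ i ∈ Finset.Icc (1 : ℤ) (m : ℤ), ∑ j ∈ Finset.Icc (1 : ℤ) (m : ℤ),
    if i = j then 0 else F i j

/-- The discrete cross ratio
`g_{ij} = ‖Δᵢʲf‖‖Δ_{i+1}^{j+1}f‖/(‖Δᵢf‖‖Δⱼf‖)`. -/
def crossRatio {n : ℕ} (f : ℝ → EuclideanSpace ℝ (Fin n)) (θ : ℤ → ℝ)
    (i j : ℤ) : ℝ :=
  (chn f θ i j * chn f θ (i + 1) (j + 1)) / (‖edge f θ i‖ * ‖edge f θ j‖)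

/-- The unit tangent vector `t = f'/‖f'‖`. -/
def tang {n : ℕ} (f : ℝ → EuclideanSpace ℝ (Fin n)) (x : ℝ) :
    EuclideanSpace ℝ (Fin n) := ‖deriv f x‖⁻¹ • deriv f x

/-- The intrinsic (arclength) distance between the points `f a` and `f b`:
the smaller of the arclengths of the two arcs joining them. -/
def intrDist {n : ℕ} (f : ℝ → EuclideanSpace ℝ (Fin n)) (a b : ℝ) : ℝ :=
  min |∫ t in a..b, ‖deriv f t‖| ((∫ t in (0:ℝ)..1, ‖deriv f t‖) - |∫ t in a..b, ‖deriv f t‖|)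

/-- The Möbius energy of a closed curve `f : ℝ/ℤ → ℝⁿ`. -/
def mobiusEnergy {n : ℕ} (f : ℝ → EuclideanSpace ℝ (Fin n)) : ℝ :=
  ∫ a in (0:ℝ)..1, ∫ b in (0:ℝ)..1,
    (1 / ‖f a - f b‖ ^ 2 - 1 / intrDist f a b ^ 2) * (‖deriv f a‖ * ‖deriv f b‖)

/-- The first decomposed energy `E₁(f)`. -/
def energyE1 {n : ℕ} (f : ℝ → EuclideanSpace ℝ (Fin n)) : ℝ :=
  (1 / 2) * ∫ a in (0:ℝ)..1, ∫ b in (0:ℝ)..1,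
    ‖tang f a - tang f b‖ ^ 2 * (‖deriv f a‖ * ‖deriv f b‖) / ‖f a - f b‖ ^ 2

/-- The second decomposed energy `E₂(f)`. -/
def energyE2 {n : ℕ} (f : ℝ → EuclideanSpace ℝ (Fin n)) : ℝ :=
  ∫ a in (0:ℝ)..1, ∫ b in (0:ℝ)..1,
    (2 * (‖deriv f a‖ * ‖deriv f b‖) / ‖f a - f b‖ ^ 2) *
      (⟪tang f a, tang f b⟫ -
        ⟪‖f a - f b‖⁻¹ • (f a - f b), tang f a⟫ *
          ⟪‖f a - f b‖⁻¹ • (f a - f b), tang f b⟫)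


lemma abs_mul_sub_mul_sub_one_mul_sq_le {a b p r x y δ k ω κ : ℝ} (hk : 1 ≤ k) (hω : 0 ≤ ω)
    (hκ : 0 ≤ κ) (ha : k - 4 * ω * k ≤ a) (ha' : a ≤ k) (hb : k - 4 * ω * k ≤ b) (hb' : b ≤ k)
    (hp : k - 1 - 4 * ω * k ≤ p) (hp' : p ≤ k - 1) (hr : k + 1 - 4 * ω * k ≤ r) (hr' : r ≤ k + 1)
    (hx : k - 4 * ω * k ≤ x) (hx' : x ≤ k) (hy : k - 4 * ω * k ≤ y) (hy' : y ≤ k)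
    (hp0 : 0 ≤ p) (hr0 : 0 ≤ r) (hκa : κ * k ≤ a) (hκb : κ * k ≤ b) (hδ : 0 ≤ δ) (hδ' : δ ≤ ω)
    (hxa : |x| ≤ a)
    (h : a ^ 2 * b ^ 2 - p ^ 2 * r ^ 2 = 4 * (x * y) - 2 * a ^ 2 + a ^ 2 * δ + 2 * (x - y) - 1) :
    |a * b - p * r - 1| * κ ^ 2 ≤ 73 * ω := by
  have ha0 : 0 ≤ a := (abs_nonneg x).trans hxa
  have hb0 : 0 ≤ b := le_trans (by positivity) hκb
  have hωk : 0 ≤ ω * k := by positivity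
  have prod : ∀ s t S T : ℝ, |s| ≤ S → S - 4 * ω * k ≤ s → s ≤ S → t ≤ T → T - 4 * ω * k ≤ t →
      0 ≤ T → |s * t - S * T| ≤ 4 * ω * k * (S + T) := by
    intro s t S T h1 h2 h3 h4 h5 h6
    have e : s * t - S * T = s * (t - T) + (s - S) * T := by ring
    rw [e]
    have t1 : |t - T| ≤ 4 * ω * k := by rw [abs_le]; constructor <;> linarith
    have t2 : |s - S| ≤ 4 * ω * k := by rw [abs_le]; constructor <;> linarith
    calc |s * (t - T) + (s - S) * T| ≤ |s| * |t - T| + |s - S| * |T| := by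
          rw [← abs_mul, ← abs_mul]; exact abs_add_le _ _
      _ ≤ S * (4 * ω * k) + (4 * ω * k) * T := by
          rw [abs_of_nonneg h6]
          gcongr
          exact (abs_nonneg _).trans h1
      _ = _ := by ring
  have h1 := prod x y k k (hxa.trans ha') hx hx' hy' hy (by linarith)
  have h2 := prod a a k k (by rwa [abs_of_nonneg ha0]) ha ha' ha' ha (by linarith)
  have h3 := prod a b k k (by rwa [abs_of_nonneg ha0]) ha ha' hb' hb (by linarith)
  have h4 := prod p r (k - 1) (k + 1) (by rwa [abs_of_nonneg hp0]) hp hp' hr' hr (by linarith)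
  rw [abs_le] at h1 h2 h3 h4
  have h5 : a ^ 2 * δ ≤ k ^ 2 * ω := by gcongr
  have h5' : 0 ≤ a ^ 2 * δ := by positivity
  have h6 : ω * k ≤ ω * k ^ 2 := by nlinarith
  have key : |(a * b - p * r - 1) * (a * b + p * r)| ≤ 73 * ω * k ^ 2 := by
    have e : (a * b - p * r - 1) * (a * b + p * r)
        = 4 * (x * y) - 2 * a ^ 2 + a ^ 2 * δ + 2 * (x - y) - 1 - (a * b + p * r) := by
      rw [← h]; ring
    rw [e, abs_le]
    constructor <;> nlinarith
  rw [abs_mul] at key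
  have h7 : κ ^ 2 * k ^ 2 ≤ |a * b + p * r| := by
    rw [abs_of_nonneg (by positivity)]
    have : (κ * k) * (κ * k) ≤ a * b := mul_le_mul hκa hκb (by positivity) ha0
    nlinarith [mul_nonneg hp0 hr0]
  have h8 : |a * b - p * r - 1| * (κ ^ 2 * k ^ 2) ≤ 73 * ω * k ^ 2 :=
    (mul_le_mul_of_nonneg_left h7 (abs_nonneg _)).trans key
  have : 0 < k ^ 2 := by positivity
  nlinarith

lemma abs_mul_sub_mul_sub_mul_le {a b p r x y τ k κ : ℝ} (hk : 1 ≤ k)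
    (hκ : 0 ≤ κ) (ha' : a ≤ k) (hr' : r ≤ k + 1) (ha0 : 0 < a)
    (hp0 : 0 ≤ p) (hr0 : 0 ≤ r) (hκa : κ * k ≤ a) (hκb : κ * k ≤ b)
    (hxa : |x| ≤ a) (hya : |y| ≤ a) (hτ : |τ| ≤ 1)
    (hab : |a - b| ≤ 2) (hap : |p - a| ≤ 1) (har : |r - a| ≤ 1)
    (h : a ^ 2 * b ^ 2 - p ^ 2 * r ^ 2 = 4 * (x * y) - 2 * a ^ 2 * τ + 2 * (x - y) - 1) :
    |a * b - p * r - (2 * ((x / a) * (y / a)) - τ)| * (κ ^ 2 * k) ≤ 20 := by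
  have hb0 : 0 ≤ b := le_trans (by positivity) hκb
  set z := 2 * ((x / a) * (y / a)) - τ with hz
  have hxa1 : |x / a| ≤ 1 := by rw [abs_div, abs_of_pos ha0]; exact div_le_one_of_le₀ hxa ha0.le
  have hya1 : |y / a| ≤ 1 := by rw [abs_div, abs_of_pos ha0]; exact div_le_one_of_le₀ hya ha0.le
  have hz3 : |z| ≤ 3 := by
    have : |(x / a) * (y / a)| ≤ 1 := by
      rw [abs_mul]; exact mul_le_one₀ hxa1 (abs_nonneg _) hya1
    rw [abs_le] at *
    constructor <;> linarith
  have hza : 2 * a ^ 2 * z = 4 * (x * y) - 2 * a ^ 2 * τ := by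
    rw [hz]; field_simp; ring
  have key : (a * b - p * r - z) * (a * b + p * r)
      = 2 * (x - y) - 1 + z * (2 * a ^ 2 - a * b - p * r) := by
    have : (a * b - p * r) * (a * b + p * r) = 2 * a ^ 2 * z + 2 * (x - y) - 1 := by
      rw [hza, ← h]; ring
    linear_combination this
  have b1 : |2 * a ^ 2 - a * b - p * r| ≤ 5 * k := by
    have e : 2 * a ^ 2 - a * b - p * r = a * (a - b) - ((p - a) * r + a * (r - a)) := by ring
    have i1 : |a * (a - b)| ≤ k * 2 := by
      rw [abs_mul, abs_of_pos ha0]; gcongr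
    have i2 : |(p - a) * r| ≤ 1 * (k + 1) := by
      rw [abs_mul, abs_of_nonneg hr0]; gcongr
    have i3 : |a * (r - a)| ≤ k * 1 := by
      rw [abs_mul, abs_of_pos ha0]; gcongr
    rw [e]
    rw [abs_le] at *
    constructor <;> linarith
  have b2 : |z * (2 * a ^ 2 - a * b - p * r)| ≤ 3 * (5 * k) := by
    rw [abs_mul]; gcongr
  have b3 : |(a * b - p * r - z) * (a * b + p * r)| ≤ 20 * k := by
    rw [key]
    rw [abs_le] at *
    constructor <;> linarith
  rw [abs_mul] at b3
  have h7 : κ ^ 2 * k ^ 2 ≤ |a * b + p * r| := by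
    rw [abs_of_nonneg (by positivity)]
    have : (κ * k) * (κ * k) ≤ a * b := mul_le_mul hκa hκb (by positivity) ha0.le
    nlinarith [mul_nonneg hp0 hr0]
  have h8 : |a * b - p * r - z| * (κ ^ 2 * k ^ 2) ≤ 20 * k :=
    (mul_le_mul_of_nonneg_left h7 (abs_nonneg _)).trans b3
  have : 0 < k := by positivity
  refine le_of_mul_le_mul_right ?_ this
  linarith

lemma abs_crossRatio_numerator_le {a b c p q r s k ω κ Λ : ℝ} (hk : 1 ≤ k) (hω : 0 ≤ ω)
    (hωΛ : ω ≤ Λ ^ 2) (hκ : 0 < κ) (ha : k - 4 * ω * k ≤ a) (ha' : a ≤ k) (ha0 : 0 ≤ a)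
    (hb0 : 0 ≤ b) (hb' : b ≤ k) (hc : k - 4 * ω * k ≤ c) (hc' : c ≤ k) (hc0 : 0 ≤ c)
    (hα : |a * b - p * r - 1| * κ ^ 2 ≤ 73 * ω) (hβ : |b * c - q * s - 1| * κ ^ 2 ≤ 73 * ω) :
    |2 * (a * b) - (a * b) * (b * c) + (p * q) * (r * s) - 1| ≤
      ω * k ^ 2 * (4 + 292 / κ ^ 2 + (73 / κ ^ 2) ^ 2 * Λ ^ 2) := by
  have hκ2 : 0 < κ ^ 2 := by positivity
  rw [← le_div_iff₀ hκ2] at hα hβ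
  obtain ⟨α, hαd⟩ : ∃ α, α = a * b - p * r - 1 := ⟨_, rfl⟩
  obtain ⟨β, hβd⟩ : ∃ β, β = b * c - q * s - 1 := ⟨_, rfl⟩
  rw [← hαd] at hα
  rw [← hβd] at hβ
  have e : 2 * (a * b) - (a * b) * (b * c) + (p * q) * (r * s) - 1
      = b * (a - c) - α * (b * c) - β * (a * b) + α * β + α + β := by
    rw [hαd, hβd]; ring
  set G := 73 * ω / κ ^ 2 with hG
  have hG0 : 0 ≤ G := by positivity
  have i1 : |b * (a - c)| ≤ k * (4 * ω * k) := by
    rw [abs_mul, abs_of_nonneg hb0]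
    gcongr
    rw [abs_le]; constructor <;> linarith
  have i2 : |α * (b * c)| ≤ G * (k * k) := by
    rw [abs_mul, abs_of_nonneg (mul_nonneg hb0 hc0)]; gcongr
  have i3 : |β * (a * b)| ≤ G * (k * k) := by
    rw [abs_mul, abs_of_nonneg (mul_nonneg ha0 hb0)]; gcongr
  have i4 : |α * β| ≤ G * G := by rw [abs_mul]; gcongr
  have hk2 : 1 ≤ k ^ 2 := one_le_pow₀ hk
  have i5 : G * G ≤ ω * k ^ 2 * ((73 / κ ^ 2) ^ 2 * Λ ^ 2) := by
    calc G * G = ω * 1 * ((73 / κ ^ 2) ^ 2 * ω) := by rw [hG]; ring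
      _ ≤ ω * k ^ 2 * ((73 / κ ^ 2) ^ 2 * Λ ^ 2) := by gcongr
  have i6 : G ≤ G * k ^ 2 := le_mul_of_one_le_right hG0 hk2
  have i7 : G * k ^ 2 * 4 = ω * k ^ 2 * (292 / κ ^ 2) := by rw [hG]; ring
  rw [e]
  rw [abs_le] at *
  constructor <;> nlinarith

lemma abs_crossRatio_numerator_sub_le {a b c p q r s z z' k κ Z : ℝ} (hk : 1 ≤ k) (hκ : 0 < κ)
    (ha' : a ≤ k) (ha0 : 0 ≤ a) (hb0 : 0 ≤ b) (hb' : b ≤ k) (hc' : c ≤ k) (hc0 : 0 ≤ c)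
    (hab : |a - b| ≤ 2) (hbc : |b - c| ≤ 2) (hz : |z| ≤ 3) (hz' : |z'| ≤ 3)
    (hzz : |z' - z| * k ≤ Z)
    (hα : |a * b - p * r - z| * (κ ^ 2 * k) ≤ 20)
    (hβ : |b * c - q * s - z'| * (κ ^ 2 * k) ≤ 20) :
    |2 * (a * b) - (a * b) * (b * c) + (p * q) * (r * s) - 1 - 2 * b ^ 2 * (1 - z)| ≤
      k * (17 + 40 / κ ^ 2 + Z + (3 + 20 / κ ^ 2) ^ 2) := by
  have hκ2 : 0 < κ ^ 2 := by positivity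
  have hk0 : 0 < k := by positivity
  set Q := 20 / κ ^ 2 with hQ
  have hQ0 : 0 ≤ Q := by positivity
  have hα1 : |a * b - p * r - z| * k ≤ Q := by
    rw [hQ, le_div_iff₀ hκ2]; linarith
  have hβ1 : |b * c - q * s - z'| * k ≤ Q := by
    rw [hQ, le_div_iff₀ hκ2]; linarith
  obtain ⟨α, hαd⟩ : ∃ α, α = a * b - p * r := ⟨_, rfl⟩
  obtain ⟨β, hβd⟩ : ∃ β, β = b * c - q * s := ⟨_, rfl⟩
  rw [← hαd] at hα1
  rw [← hβd] at hβ1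
  have e : 2 * (a * b) - (a * b) * (b * c) + (p * q) * (r * s) - 1 - 2 * b ^ 2 * (1 - z)
      = 2 * (b * (a - b)) - (α - z) * (b * c) - z * (b * (c - b)) - (β - z') * (a * b)
        - (z' - z) * (a * b) - z * (b * (a - b)) + α * β - 1 := by
    rw [hαd, hβd]; ring
  have i1 : |b * (a - b)| ≤ k * 2 := by
    rw [abs_mul, abs_of_nonneg hb0]; gcongr
  have i1' : |b * (c - b)| ≤ k * 2 := by
    rw [abs_mul, abs_of_nonneg hb0, abs_sub_comm]; gcongr
  have i2 : |(α - z) * (b * c)| ≤ Q * k := by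
    rw [abs_mul, abs_of_nonneg (mul_nonneg hb0 hc0)]
    calc |α - z| * (b * c) ≤ |α - z| * (k * k) := by gcongr
      _ = (|α - z| * k) * k := by ring
      _ ≤ _ := by gcongr
  have i3 : |(β - z') * (a * b)| ≤ Q * k := by
    rw [abs_mul, abs_of_nonneg (mul_nonneg ha0 hb0)]
    calc |β - z'| * (a * b) ≤ |β - z'| * (k * k) := by gcongr
      _ = (|β - z'| * k) * k := by ring
      _ ≤ _ := by gcongr
  have i4 : |(z' - z) * (a * b)| ≤ Z * k := by
    rw [abs_mul, abs_of_nonneg (mul_nonneg ha0 hb0)]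
    calc |z' - z| * (a * b) ≤ |z' - z| * (k * k) := by gcongr
      _ = (|z' - z| * k) * k := by ring
      _ ≤ _ := by gcongr
  have i5 : |z * (b * (c - b))| ≤ 3 * (k * 2) := by rw [abs_mul]; gcongr
  have i6 : |z * (b * (a - b))| ≤ 3 * (k * 2) := by rw [abs_mul]; gcongr
  have j1 : |α| ≤ 3 + Q := by
    have : |α - z| ≤ Q := le_trans (by nlinarith [abs_nonneg (α - z)]) hα1
    rw [abs_le] at *; constructor <;> linarith
  have j2 : |β| ≤ 3 + Q := by
    have : |β - z'| ≤ Q := le_trans (by nlinarith [abs_nonneg (β - z')]) hβ1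
    rw [abs_le] at *; constructor <;> linarith
  have i7 : |α * β| ≤ (3 + Q) ^ 2 * k := by
    rw [abs_mul]
    calc |α| * |β| ≤ (3 + Q) * (3 + Q) := by gcongr
      _ = (3 + Q) ^ 2 * 1 := by ring
      _ ≤ _ := by gcongr
  have e2 : 40 / κ ^ 2 = 2 * Q := by rw [hQ]; ring
  rw [e, e2]
  rw [abs_le] at *
  constructor <;> linarith

lemma norm_sub_add_nat_le {E : Type*} [SeminormedAddCommGroup E] {u : ℤ → E} {l : ℝ}
    (hl : ∀ i, ‖u (i + 1) - u i‖ ≤ l) (i : ℤ) (k : ℕ) : ‖u (i + k) - u i‖ ≤ l * k := by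
  induction k with
  | zero => simp
  | succ k ih =>
    have e : u (i + (k + 1 : ℕ)) - u i = (u (i + k + 1) - u (i + k)) + (u (i + k) - u i) := by
      push_cast; rw [← add_assoc]; abel
    rw [e]
    refine (norm_add_le _ _).trans ?_
    push_cast
    linarith [hl (i + k)]

lemma natCast_sub_le_inner_chord {E : Type*} [NormedAddCommGroup E] [InnerProductSpace ℝ E]
    {X u : ℤ → E} (hX : ∀ i, X (i + 1) - X i = u i) (hu : ∀ i, ‖u i‖ = 1) {v : E} (hv : ‖v‖ = 1)
    {μ : ℝ} (i : ℤ) (k : ℕ) (hμ : ∀ l : ℕ, l < k → ‖v - u (i + l)‖ ≤ μ) :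
    k - k * μ ^ 2 / 2 ≤ ⟪X (i + k) - X i, v⟫ := by
  induction k with
  | zero => simp
  | succ k ih =>
    have e : X (i + (k + 1 : ℕ)) - X i = (X (i + k) - X i) + u (i + k) := by
      rw [← hX]; push_cast; rw [← add_assoc]; abel
    rw [e, inner_add_left]
    have h1 := ih fun l hl => hμ l (hl.trans k.lt_succ_self)
    have h2 := hμ k k.lt_succ_self
    have h3 : ‖v - u (i + k)‖ ^ 2 ≤ μ ^ 2 := by gcongr
    rw [norm_sub_sq_real, hv, hu, real_inner_comm] at h3
    push_cast
    linarith

lemma norm_chord_le_natCast {E : Type*} [NormedAddCommGroup E]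
    {X u : ℤ → E} (hX : ∀ i, X (i + 1) - X i = u i) (hu : ∀ i, ‖u i‖ = 1) (i : ℤ) (k : ℕ) :
    ‖X (i + k) - X i‖ ≤ k := by
  have := norm_sub_add_nat_le (u := X) (l := 1) (fun i => by rw [hX, hu]) i k
  simpa using this

lemma unit_polygon_chord_bounds {E : Type*} [NormedAddCommGroup E] [InnerProductSpace ℝ E]
    {X u : ℤ → E} (hX : ∀ i, X (i + 1) - X i = u i) (hu : ∀ i, ‖u i‖ = 1) {l : ℝ}
    (hl : ∀ i, ‖u (i + 1) - u i‖ ≤ l) (i : ℤ) (k : ℕ) :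
    ‖X (i + k) - X i‖ ≤ k ∧ k - l ^ 2 * k ^ 3 / 2 ≤ ‖X (i + k) - X i‖ ∧
    k - l ^ 2 * k ^ 3 / 2 ≤ ⟪X (i + k) - X i, u i⟫ ∧
    k - l ^ 2 * k ^ 3 / 2 ≤ ⟪X (i + k) - X i, u (i + k)⟫ ∧
    |⟪X (i + k) - X i, u i⟫| ≤ ‖X (i + k) - X i‖ ∧
    |⟪X (i + k) - X i, u (i + k)⟫| ≤ ‖X (i + k) - X i‖ := by
  have hl0 : 0 ≤ l := (norm_nonneg _).trans (hl 0)
  have cs : ∀ j, |⟪X (i + k) - X i, u j⟫| ≤ ‖X (i + k) - X i‖ := fun j => by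
    simpa [hu] using abs_real_inner_le_norm (X (i + k) - X i) (u j)
  have h1 : k - l ^ 2 * k ^ 3 / 2 ≤ ⟪X (i + k) - X i, u i⟫ := by
    have := natCast_sub_le_inner_chord hX hu (hu i) (μ := l * k) i k fun t ht => by
      rw [norm_sub_rev]
      refine (norm_sub_add_nat_le hl i t).trans ?_
      gcongr
    calc _ = (k : ℝ) - k * (l * k) ^ 2 / 2 := by ring
      _ ≤ _ := this
  have h2 : k - l ^ 2 * k ^ 3 / 2 ≤ ⟪X (i + k) - X i, u (i + k)⟫ := by
    have := natCast_sub_le_inner_chord hX hu (hu (i + k)) (μ := l * k) i k fun t ht => by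
      obtain ⟨s, rfl⟩ := Nat.exists_eq_add_of_lt ht
      have h := norm_sub_add_nat_le hl (i + t) (s + 1)
      have e : i + (t + s + 1 : ℕ) = i + t + ((s + 1 : ℕ) : ℤ) := by push_cast; ring
      rw [e]
      refine h.trans ?_
      gcongr
      omega
    calc _ = (k : ℝ) - k * (l * k) ^ 2 / 2 := by ring
      _ ≤ _ := this
  exact ⟨norm_chord_le_natCast hX hu i k, h1.trans ((le_abs_self _).trans (cs i)), h1, h2, cs _, cs _⟩

lemma unit_polygon_chord_identity {E : Type*} [NormedAddCommGroup E] [InnerProductSpace ℝ E]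
    {X u : ℤ → E} (hX : ∀ i, X (i + 1) - X i = u i) (hu : ∀ i, ‖u i‖ = 1) (i j : ℤ) :
    ‖X j - X i‖ ^ 2 * ‖X (j + 1) - X (i + 1)‖ ^ 2 - ‖X j - X (i + 1)‖ ^ 2 * ‖X (j + 1) - X i‖ ^ 2
      = 4 * (⟪X j - X i, u i⟫ * ⟪X j - X i, u j⟫) - 2 * ‖X j - X i‖ ^ 2 * ⟪u i, u j⟫
        + 2 * (⟪X j - X i, u i⟫ - ⟪X j - X i, u j⟫) - 1 := by
  have e1 : X (j + 1) - X (i + 1) = (X j - X i) + u j - u i := by rw [← hX, ← hX]; abel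
  have e2 : X j - X (i + 1) = (X j - X i) - u i := by rw [← hX]; abel
  have e3 : X (j + 1) - X i = (X j - X i) + u j := by rw [← hX]; abel
  rw [e1, e2, e3]
  generalize X j - X i = c
  rw [norm_sub_sq_real, norm_sub_sq_real c, norm_add_sq_real, inner_add_left, hu, hu,
    real_inner_comm (u i) (u j)]
  ring

lemma norm_normalize_sub_le {E : Type*} [NormedAddCommGroup E] [NormedSpace ℝ E] (x y : E)
    (hy : y ≠ 0) : ‖‖x‖⁻¹ • x - ‖y‖⁻¹ • y‖ ≤ 2 * ‖x - y‖ / ‖y‖ := by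
  have hy' : 0 < ‖y‖ := norm_pos_iff.2 hy
  rcases eq_or_ne x 0 with rfl | hx
  · rw [norm_zero, smul_zero, zero_sub, norm_neg, norm_smul, norm_inv, norm_norm,
      inv_mul_cancel₀ hy'.ne', zero_sub, norm_neg, mul_div_assoc, div_self hy'.ne']
    norm_num
  have hx' : 0 < ‖x‖ := norm_pos_iff.2 hx
  have e : ‖x‖⁻¹ • x - ‖y‖⁻¹ • y = ‖y‖⁻¹ • (x - y) + ((‖y‖ - ‖x‖) / (‖x‖ * ‖y‖)) • x := by
    have : (‖y‖ - ‖x‖) / (‖x‖ * ‖y‖) = ‖x‖⁻¹ - ‖y‖⁻¹ := by field_simp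
    rw [this]; module
  rw [e]
  refine (norm_add_le _ _).trans ?_
  rw [norm_smul, norm_smul, norm_inv, norm_norm, norm_div, norm_mul, norm_norm, norm_norm,
    Real.norm_eq_abs]
  have h1 : |‖y‖ - ‖x‖| ≤ ‖x - y‖ := by rw [norm_sub_rev]; exact abs_norm_sub_norm_le y x
  have e2 : |‖y‖ - ‖x‖| / (‖x‖ * ‖y‖) * ‖x‖ = |‖y‖ - ‖x‖| / ‖y‖ := by field_simp
  rw [e2, ← div_eq_inv_mul, ← add_div]
  gcongr
  linarith

lemma abs_one_add_sub_two_mul_div_le {a x y τ δ k l κ : ℝ} (hk : 1 ≤ k)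
    (hκ : 0 < κ) (ha : k - 4 * (l ^ 2 * k ^ 2) * k ≤ a) (ha' : a ≤ k)
    (hx : k - 4 * (l ^ 2 * k ^ 2) * k ≤ x) (hy : k - 4 * (l ^ 2 * k ^ 2) * k ≤ y)
    (hκa : κ * k ≤ a) (hδ : 0 ≤ δ) (hδ' : δ ≤ l ^ 2 * k ^ 2)
    (hxa : |x| ≤ a) (hya : |y| ≤ a) (hτ : τ = 1 - δ / 2) :
    |(1 + τ - 2 * ((x / a) * (y / a))) / a ^ 2| ≤ 33 / κ ^ 4 * l ^ 2 := by
  have hκk : 0 < κ * k := by positivity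
  have ha0 : 0 < a := hκk.trans_le hκa
  set ω := l ^ 2 * k ^ 2 with hω
  have hω0 : 0 ≤ ω := by positivity
  have hωk : 0 ≤ 4 * ω * k := by positivity
  have e : (1 + τ - 2 * ((x / a) * (y / a))) / a ^ 2
      = (2 * (a * a) - 2 * (x * y) - a ^ 2 * δ / 2) / a ^ 4 := by
    rw [hτ]; field_simp; ring
  have prod : ∀ s t : ℝ, |s| ≤ a → |t| ≤ a → k - 4 * ω * k ≤ s → k - 4 * ω * k ≤ t →
      |s * t - k * k| ≤ 8 * ω * k ^ 2 := by
    intro s t h1 h2 h3 h4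
    have e : s * t - k * k = s * (t - k) + (s - k) * k := by ring
    have h1' := abs_le.1 h1
    have h2' := abs_le.1 h2
    have t1 : |t - k| ≤ 4 * ω * k := by rw [abs_le]; constructor <;> linarith
    have t2 : |s - k| ≤ 4 * ω * k := by rw [abs_le]; constructor <;> linarith
    rw [e]
    calc |s * (t - k) + (s - k) * k| ≤ |s| * |t - k| + |s - k| * |k| := by
          rw [← abs_mul, ← abs_mul]; exact abs_add_le _ _
      _ ≤ k * (4 * ω * k) + (4 * ω * k) * k := by
          rw [abs_of_nonneg (by linarith : 0 ≤ k)]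
          gcongr
          exact h1.trans ha'
      _ = _ := by ring
  have h1 := abs_le.1 (prod x y hxa hya hx hy)
  have h2 := abs_le.1 (prod a a (abs_of_pos ha0).le (abs_of_pos ha0).le ha ha)
  have h5 : a ^ 2 * δ ≤ k ^ 2 * ω := by gcongr
  have h5' : 0 ≤ a ^ 2 * δ := by positivity
  have h3 : |2 * (a * a) - 2 * (x * y) - a ^ 2 * δ / 2| ≤ 33 * ω * k ^ 2 := by
    rw [abs_le]; constructor <;> linarith
  rw [e, abs_div, abs_of_pos (by positivity : 0 < a ^ 4), div_le_iff₀ (by positivity)]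
  have hk0 : 0 < k := by linarith
  calc _ ≤ 33 * ω * k ^ 2 := h3
    _ = 33 / κ ^ 4 * l ^ 2 * (κ * k) ^ 4 := by rw [hω]; field_simp
    _ ≤ _ := by gcongr

set_option maxHeartbeats 800000 in
/-- Edge-length-one polygons: near-diagonal and far-from-diagonal bounds for the
principal part and for the remainder of the discrete energy density. -/
theorem unit_polygon_density_bounds {E : Type*} [NormedAddCommGroup E] [InnerProductSpace ℝ E]
    {κ Λ : ℝ} (hκ : 0 < κ) :
    ∃ C : ℝ, ∀ (X u : ℤ → E) (l : ℝ), (∀ i, X (i + 1) - X i = u i) → (∀ i, ‖u i‖ = 1) →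
      (∀ i, ‖u (i + 1) - u i‖ ≤ l) → ∀ (i j : ℤ) (k : ℕ), j = i + k → 1 ≤ k → l * k ≤ Λ →
      κ * k ≤ ‖X j - X i‖ → κ * k ≤ ‖X (j + 1) - X (i + 1)‖ →
      κ * k ≤ ‖X (j + 1 + 1) - X (i + 1 + 1)‖ →
      ∀ a b c p q r s P : ℝ, ‖X j - X i‖ = a → ‖X (j + 1) - X (i + 1)‖ = b →
        ‖X (j + 1 + 1) - X (i + 1 + 1)‖ = c → ‖X j - X (i + 1)‖ = p →
        ‖X (j + 1) - X (i + 1 + 1)‖ = q → ‖X (j + 1) - X i‖ = r →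
        ‖X (j + 1 + 1) - X (i + 1)‖ = s →
        P = (1 + ⟪u i, u j⟫ - 2 * (⟪X j - X i, u i⟫ / a * (⟪X j - X i, u j⟫ / a))) / a ^ 2 →
        |P| ≤ C * l ^ 2 ∧
        |(2 * (a * b) - (a * b) * (b * c) + (p * q) * (r * s) - 1) / (2 * (a * b) ^ 2) - P|
          ≤ C * l ^ 2 ∧
        |(2 * (a * b) - (a * b) * (b * c) + (p * q) * (r * s) - 1) / (2 * (a * b) ^ 2) - P|
          ≤ C / k ^ 3 := by
  set C₁ := 33 / κ ^ 4
  set C₂ := (4 + 292 / κ ^ 2 + (73 / κ ^ 2) ^ 2 * Λ ^ 2) / (2 * κ ^ 4) with hC₂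
  set Z := 4 * (Λ + 4 / κ) + 2 * Λ with hZ
  set C₃ := (17 + 40 / κ ^ 2 + Z + (3 + 20 / κ ^ 2) ^ 2) / (2 * κ ^ 4) with hC₃
  have hC₁0 : 0 ≤ C₁ := by positivity
  have hC₂0 : 0 ≤ C₂ := by positivity
  refine ⟨C₁ + C₂ + |C₃|, ?_⟩
  intro X u l hX hu hl i j k hj hk hlk hκa hκb hκc a b c p q r s P ha hb hc hp hq hr hs hP
  have hl0 : 0 ≤ l := (norm_nonneg _).trans (hl 0)
  have hk1 : (1 : ℝ) ≤ k := by exact_mod_cast hk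
  have hk0 : (0 : ℝ) < k := by linarith
  have hΛ : 0 ≤ Λ := le_trans (by positivity) hlk
  have hZ0 : 0 ≤ Z := by positivity
  have hC₃0 : 0 ≤ C₃ := by positivity
  rw [abs_of_nonneg hC₃0]
  have hκk : 0 < κ * k := by positivity
  set ω := l ^ 2 * (k : ℝ) ^ 2 with hω
  have hω0 : 0 ≤ ω := by positivity
  have hωΛ : ω ≤ Λ ^ 2 := by rw [hω, ← mul_pow]; gcongr
  have weak : ∀ t : ℝ, 0 ≤ t → t ≤ k + 1 → l ^ 2 * t ^ 3 / 2 ≤ 4 * ω * k := by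
    intro t h0 h1
    have : t ≤ 2 * k := by linarith
    calc l ^ 2 * t ^ 3 / 2 ≤ l ^ 2 * (2 * k) ^ 3 / 2 := by gcongr
      _ = 4 * ω * k := by rw [hω]; ring
  have weakk := weak k hk0.le (by linarith)
  obtain ⟨t, rfl⟩ : ∃ t, k = t + 1 := ⟨k - 1, by omega⟩
  have ht : ((t + 1 : ℕ) : ℝ) - 1 = t := by push_cast; ring
  have weakp := weak t t.cast_nonneg (by linarith)
  have weakr := weak ((t + 1 + 1 : ℕ) : ℝ) (by positivity) (by push_cast; linarith)
  have e1 : j + 1 = (i + 1) + (t + 1 : ℕ) := by rw [hj]; ring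
  have e2 : j + 1 + 1 = (i + 1 + 1) + (t + 1 : ℕ) := by rw [hj]; ring
  have e3 : j = (i + 1) + t := by rw [hj]; push_cast; ring
  have e4 : j + 1 = (i + 1 + 1) + t := by rw [hj]; push_cast; ring
  have e5 : j + 1 = i + (t + 1 + 1 : ℕ) := by rw [hj]; push_cast; ring
  have e6 : j + 1 + 1 = i + 1 + (t + 1 + 1 : ℕ) := by rw [hj]; push_cast; ring
  have Ba := unit_polygon_chord_bounds hX hu hl i (t + 1)
  have Bb := unit_polygon_chord_bounds hX hu hl (i + 1) (t + 1)
  have Bc := unit_polygon_chord_bounds hX hu hl (i + 1 + 1) (t + 1)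
  have Bp := unit_polygon_chord_bounds hX hu hl (i + 1) t
  have Bq := unit_polygon_chord_bounds hX hu hl (i + 1 + 1) t
  have Br := unit_polygon_chord_bounds hX hu hl i (t + 1 + 1)
  have Bs := unit_polygon_chord_bounds hX hu hl (i + 1) (t + 1 + 1)
  rw [← hj, ha] at Ba
  rw [← e1, hb] at Bb
  rw [← e2, hc] at Bc
  rw [← e3, hp] at Bp
  rw [← e4, hq] at Bq
  rw [← e5, hr] at Br
  rw [← e6, hs] at Bs
  have I1 := unit_polygon_chord_identity hX hu i j
  have I2 := unit_polygon_chord_identity hX hu (i + 1) (j + 1)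
  rw [ha, hb, hp, hr] at I1
  rw [hb, hc, hq, hs] at I2
  rw [ha] at hκa
  rw [hb] at hκb
  rw [hc] at hκc
  have dab : |a - b| ≤ 2 := by
    rw [← ha, ← hb]
    refine (abs_norm_sub_norm_le _ _).trans ?_
    have : X j - X i - (X (j + 1) - X (i + 1)) = u i - u j := by rw [← hX, ← hX]; abel
    rw [this]
    exact (norm_sub_le _ _).trans (by rw [hu, hu]; norm_num)
  have dbc : |b - c| ≤ 2 := by
    rw [← hb, ← hc]
    refine (abs_norm_sub_norm_le _ _).trans ?_
    have : X (j + 1) - X (i + 1) - (X (j + 1 + 1) - X (i + 1 + 1)) = u (i + 1) - u (j + 1) := by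
      rw [← hX, ← hX]; abel
    rw [this]
    exact (norm_sub_le _ _).trans (by rw [hu, hu]; norm_num)
  have tri : ∀ (v w : E) (n : ℤ), v - w = u n ∨ v - w = - u n → |‖v‖ - ‖w‖| ≤ 1 := by
    intro v w n h
    refine (abs_norm_sub_norm_le _ _).trans ?_
    rcases h with h | h <;> simp [h, hu]
  have dpa : |p - a| ≤ 1 := by
    rw [← ha, ← hp]; exact tri _ _ i (Or.inr (by rw [← hX]; abel))
  have dra : |r - a| ≤ 1 := by
    rw [← ha, ← hr]; exact tri _ _ j (Or.inl (by rw [← hX]; abel))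
  have dqb : |q - b| ≤ 1 := by
    rw [← hb, ← hq]; exact tri _ _ (i + 1) (Or.inr (by rw [← hX]; abel))
  have dsb : |s - b| ≤ 1 := by
    rw [← hb, ← hs]; exact tri _ _ (j + 1) (Or.inl (by rw [← hX]; abel))
  have dδ : ∀ n : ℤ, ‖u n - u (n + (t + 1 : ℕ))‖ ^ 2 ≤ ω := by
    intro n
    rw [norm_sub_rev, hω, ← mul_pow]
    gcongr
    exact norm_sub_add_nat_le hl n (t + 1)
  have dδ1 := dδ i
  have dδ2 := dδ (i + 1)
  rw [← hj] at dδ1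
  rw [← e1] at dδ2
  have uu : ∀ n m : ℤ, ⟪u n, u m⟫ = 1 - ‖u n - u m‖ ^ 2 / 2 := by
    intro n m
    rw [norm_sub_sq_real, hu, hu]; ring
  have dτ : ∀ n m : ℤ, |⟪u n, u m⟫| ≤ 1 := by
    intro n m
    simpa [hu] using abs_real_inner_le_norm (u n) (u m)
  have a0 : 0 < a := hκk.trans_le hκa
  have b0 : 0 < b := hκk.trans_le hκb
  have c0 : 0 ≤ c := by rw [← hc]; exact norm_nonneg _
  have p0 : 0 ≤ p := by rw [← hp]; exact norm_nonneg _
  have q0 : 0 ≤ q := by rw [← hq]; exact norm_nonneg _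
  have r0 : 0 ≤ r := by rw [← hr]; exact norm_nonneg _
  have s0 : 0 ≤ s := by rw [← hs]; exact norm_nonneg _
  have cr : ((t + 1 + 1 : ℕ) : ℝ) = ((t + 1 : ℕ) : ℝ) + 1 := by push_cast; ring
  have ctp : (t : ℝ) = ((t + 1 : ℕ) : ℝ) - 1 := by push_cast; ring
  obtain ⟨a1, a2, a3, a4, a5, a6⟩ := Ba
  obtain ⟨b1, b2, b3, b4, b5, b6⟩ := Bb
  obtain ⟨c1, c2, -, -, -, -⟩ := Bc
  obtain ⟨p1, p2, -, -, -, -⟩ := Bp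
  obtain ⟨q1, q2, -, -, -, -⟩ := Bq
  obtain ⟨r1, r2, -, -, -, -⟩ := Br
  obtain ⟨s1, s2, -, -, -, -⟩ := Bs
  obtain ⟨x, hx⟩ : ∃ x, x = ⟪X j - X i, u i⟫ := ⟨_, rfl⟩
  obtain ⟨y, hy⟩ : ∃ y, y = ⟪X j - X i, u j⟫ := ⟨_, rfl⟩
  obtain ⟨x', hx'⟩ : ∃ x, x = ⟪X (j + 1) - X (i + 1), u (i + 1)⟫ := ⟨_, rfl⟩
  obtain ⟨y', hy'⟩ : ∃ y, y = ⟪X (j + 1) - X (i + 1), u (j + 1)⟫ := ⟨_, rfl⟩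
  obtain ⟨τ, hτ⟩ : ∃ τ, τ = ⟪u i, u j⟫ := ⟨_, rfl⟩
  obtain ⟨τ', hτ'⟩ : ∃ τ, τ = ⟪u (i + 1), u (j + 1)⟫ := ⟨_, rfl⟩
  have hzz : |(2 * ((x' / b) * (y' / b)) - τ') - (2 * ((x / a) * (y / a)) - τ)| * (t + 1 : ℕ)
      ≤ Z := by
    have hatn : X j - X i ≠ 0 := by rw [← norm_pos_iff, ha]; exact a0
    have hbtn : X (j + 1) - X (i + 1) ≠ 0 := by rw [← norm_pos_iff, hb]; exact b0
    have hdir : ‖b⁻¹ • (X (j + 1) - X (i + 1)) - a⁻¹ • (X j - X i)‖ ≤ 4 / (κ * (t + 1 : ℕ)) := by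
      have h := norm_normalize_sub_le (X (j + 1) - X (i + 1)) (X j - X i) hatn
      rw [ha, hb] at h
      refine h.trans ?_
      have : ‖X (j + 1) - X (i + 1) - (X j - X i)‖ ≤ 2 := by
        have : X (j + 1) - X (i + 1) - (X j - X i) = u j - u i := by rw [← hX, ← hX]; abel
        rw [this]
        exact (norm_sub_le _ _).trans (by rw [hu, hu]; norm_num)
      gcongr
      linarith
    have hξ : ∀ n : ℤ, |⟪X (j + 1) - X (i + 1), u (n + 1)⟫ / b - ⟪X j - X i, u n⟫ / a|
        ≤ l + 4 / (κ * (t + 1 : ℕ)) := by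
      intro n
      have e : ⟪X (j + 1) - X (i + 1), u (n + 1)⟫ / b - ⟪X j - X i, u n⟫ / a
          = ⟪b⁻¹ • (X (j + 1) - X (i + 1)), u (n + 1) - u n⟫
            + ⟪b⁻¹ • (X (j + 1) - X (i + 1)) - a⁻¹ • (X j - X i), u n⟫ := by
        generalize X (j + 1) - X (i + 1) = v
        generalize X j - X i = w
        rw [inner_sub_left, inner_sub_right, real_inner_smul_left, real_inner_smul_left,
          real_inner_smul_left]
        ring
      have hnb : ‖b⁻¹ • (X (j + 1) - X (i + 1))‖ = 1 := by
        rw [norm_smul, hb, norm_inv, Real.norm_of_nonneg b0.le, inv_mul_cancel₀ b0.ne']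
      rw [e]
      refine (abs_add_le _ _).trans (add_le_add ?_ ?_)
      · refine (abs_real_inner_le_norm _ _).trans ?_
        rw [hnb, one_mul]; exact hl n
      · refine (abs_real_inner_le_norm _ _).trans ?_
        rw [hu, mul_one]; exact hdir
    have hττ : |τ' - τ| ≤ 2 * l := by
      have e : τ' - τ = ⟪u (i + 1), u (j + 1) - u j⟫ + ⟪u (i + 1) - u i, u j⟫ := by
        rw [hτ, hτ', inner_sub_left, inner_sub_right]; ring
      rw [e]
      have h1 : |⟪u (i + 1), u (j + 1) - u j⟫| ≤ l := by
        refine (abs_real_inner_le_norm _ _).trans ?_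
        rw [hu, one_mul]; exact hl j
      have h2 : |⟪u (i + 1) - u i, u j⟫| ≤ l := by
        refine (abs_real_inner_le_norm _ _).trans ?_
        rw [hu, mul_one]; exact hl i
      linarith [abs_add_le ⟪u (i + 1), u (j + 1) - u j⟫ ⟪u (i + 1) - u i, u j⟫]
    have hX1 := hξ i
    have hY1 := hξ j
    rw [← hx, ← hx'] at hX1
    rw [← hy, ← hy'] at hY1
    rw [← hx'] at b5
    rw [← hy] at a6
    have n1 : |x' / b| ≤ 1 := by rw [abs_div, abs_of_pos b0]; exact div_le_one_of_le₀ b5 b0.le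
    have n2 : |y / a| ≤ 1 := by rw [abs_div, abs_of_pos a0]; exact div_le_one_of_le₀ a6 a0.le
    have e : (2 * ((x' / b) * (y' / b)) - τ') - (2 * ((x / a) * (y / a)) - τ)
        = 2 * ((x' / b) * (y' / b - y / a)) + 2 * ((x' / b - x / a) * (y / a)) - (τ' - τ) := by
      ring
    have m1 : |(x' / b) * (y' / b - y / a)| ≤ 1 * (l + 4 / (κ * (t + 1 : ℕ))) := by
      rw [abs_mul]; gcongr
    have m2 : |(x' / b - x / a) * (y / a)| ≤ (l + 4 / (κ * (t + 1 : ℕ))) * 1 := by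
      rw [abs_mul]; gcongr
    have m3 : |(2 * ((x' / b) * (y' / b)) - τ') - (2 * ((x / a) * (y / a)) - τ)|
        ≤ 4 * (l + 4 / (κ * (t + 1 : ℕ))) + 2 * l := by
      rw [e]
      rw [abs_le] at *
      constructor <;> linarith
    calc _ ≤ (4 * (l + 4 / (κ * (t + 1 : ℕ))) + 2 * l) * (t + 1 : ℕ) := by gcongr
      _ = 4 * (l * (t + 1 : ℕ) + 4 / κ) + 2 * (l * (t + 1 : ℕ)) := by field_simp
      _ ≤ Z := by rw [hZ]; gcongr
  rw [← hx, ← hy, ← hτ] at I1 hP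
  rw [← hx', ← hy', ← hτ'] at I2
  rw [← hx] at a3 a5
  rw [← hy] at a4 a6
  rw [← hx'] at b3 b5
  rw [← hy'] at b4 b6
  rw [cr] at r1 r2 s1 s2
  rw [ctp] at p1 p2 q1 q2
  rw [cr] at weakr
  rw [ctp] at weakp
  have dτ1 := dτ i j
  have dτ2 := dτ (i + 1) (j + 1)
  have uu1 := uu i j
  have uu2 := uu (i + 1) (j + 1)
  rw [← hτ] at dτ1 uu1
  rw [← hτ'] at dτ2 uu2
  generalize ((t + 1 : ℕ) : ℝ) = K at *
  have x1 := (abs_le.1 a5).2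
  have y1 := (abs_le.1 a6).2
  have x1' := (abs_le.1 b5).2
  have y1' := (abs_le.1 b6).2
  have hα := abs_mul_sub_mul_sub_one_mul_sq_le (a := a) (b := b) (p := p) (r := r) (x := x)
    (y := y) (δ := ‖u i - u j‖ ^ 2) hk1 hω0 hκ.le (by linarith) a1 (by linarith) b1
    (by linarith) p1 (by linarith) r1 (by linarith) (by linarith) (by linarith) (by linarith)
    p0 r0 hκa hκb (by positivity) dδ1 a5 (by rw [I1, uu1]; ring)
  have hβ := abs_mul_sub_mul_sub_one_mul_sq_le (a := b) (b := c) (p := q) (r := s) (x := x')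
    (y := y') (δ := ‖u (i + 1) - u (j + 1)‖ ^ 2) hk1 hω0 hκ.le (by linarith) b1 (by linarith) c1
    (by linarith) q1 (by linarith) s1 (by linarith) (by linarith) (by linarith) (by linarith)
    q0 s0 hκb hκc (by positivity) dδ2 b5 (by rw [I2, uu2]; ring)
  have hα' := abs_mul_sub_mul_sub_mul_le (a := a) (b := b) (p := p) (r := r) (x := x) (y := y)
    (τ := τ) hk1 hκ.le a1 r1 a0 p0 r0 hκa hκb a5 a6 dτ1 dab dpa dra I1
  have hβ' := abs_mul_sub_mul_sub_mul_le (a := b) (b := c) (p := q) (r := s) (x := x') (y := y')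
    (τ := τ') hk1 hκ.le b1 s1 b0 q0 s0 hκb hκc b5 b6 dτ2 dbc dqb dsb I2
  have z3 : ∀ {x y τ a : ℝ}, 0 < a → |x| ≤ a → |y| ≤ a → |τ| ≤ 1 →
      |2 * ((x / a) * (y / a)) - τ| ≤ 3 := by
    intro x y τ a a0 h1 h2 h3
    have n1 : |x / a| ≤ 1 := by rw [abs_div, abs_of_pos a0]; exact div_le_one_of_le₀ h1 a0.le
    have n2 : |y / a| ≤ 1 := by rw [abs_div, abs_of_pos a0]; exact div_le_one_of_le₀ h2 a0.le
    have : |(x / a) * (y / a)| ≤ 1 := by rw [abs_mul]; exact mul_le_one₀ n1 (abs_nonneg _) n2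
    rw [abs_le] at *
    constructor <;> linarith
  have hN := abs_crossRatio_numerator_le (a := a) (b := b) (c := c) (p := p) (q := q) (r := r)
    (s := s) hk1 hω0 hωΛ hκ (by linarith) a1 a0.le b0.le b1 (by linarith) c1 c0 hα hβ
  have hN' := abs_crossRatio_numerator_sub_le (a := a) (b := b) (c := c) (p := p) (q := q) (r := r)
    (s := s) hk1 hκ a1 a0.le b0.le b1 c1 c0 dab dbc (z3 a0 a5 a6 dτ1) (z3 b0 b5 b6 dτ2) hzz hα' hβ'
  have hPn := abs_one_add_sub_two_mul_div_le (a := a) (x := x) (y := y) (τ := τ)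
    (δ := ‖u i - u j‖ ^ 2) (k := K) (l := l) (κ := κ) hk1 hκ (by rw [← hω]; linarith) a1
    (by rw [← hω]; linarith) (by rw [← hω]; linarith) hκa (by positivity) (by rw [← hω]; exact dδ1)
    a5 a6 uu1
  rw [← hP] at hPn
  have hab : κ ^ 2 * K ^ 2 ≤ a * b := by
    calc κ ^ 2 * K ^ 2 = (κ * K) * (κ * K) := by ring
      _ ≤ a * b := by gcongr
  have hab2 : κ ^ 4 * K ^ 4 ≤ (a * b) ^ 2 := by
    calc κ ^ 4 * K ^ 4 = (κ ^ 2 * K ^ 2) ^ 2 := by ring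
      _ ≤ _ := by gcongr
  have hM : |(2 * (a * b) - (a * b) * (b * c) + (p * q) * (r * s) - 1) / (2 * (a * b) ^ 2)|
      ≤ C₂ * l ^ 2 := by
    rw [abs_div, abs_of_pos (by positivity : 0 < 2 * (a * b) ^ 2), div_le_iff₀ (by positivity)]
    calc _ ≤ _ := hN
      _ = C₂ * l ^ 2 * (2 * (κ ^ 4 * K ^ 4)) := by
        rw [hC₂, hω]; field_simp
      _ ≤ _ := by gcongr
  refine ⟨hPn.trans ?_, ?_, ?_⟩
  · gcongr
    linarith only [hC₂0, hC₃0]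
  · have h3 := mul_nonneg hC₃0 (sq_nonneg l)
    have h4 := abs_sub ((2 * (a * b) - (a * b) * (b * c) + (p * q) * (r * s) - 1)
      / (2 * (a * b) ^ 2)) P
    linarith only [h3, h4, hM, hPn]
  · have e : (2 * (a * b) - (a * b) * (b * c) + (p * q) * (r * s) - 1) / (2 * (a * b) ^ 2) - P
        = (2 * (a * b) - (a * b) * (b * c) + (p * q) * (r * s) - 1
            - 2 * b ^ 2 * (1 - (2 * ((x / a) * (y / a)) - τ))) / (2 * (a * b) ^ 2) := by
      rw [hP]; field_simp; ring
    have : |(2 * (a * b) - (a * b) * (b * c) + (p * q) * (r * s) - 1) / (2 * (a * b) ^ 2) - P|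
        ≤ C₃ / K ^ 3 := by
      rw [e, abs_div, abs_of_pos (by positivity : 0 < 2 * (a * b) ^ 2), div_le_iff₀ (by positivity)]
      calc _ ≤ _ := hN'
        _ = C₃ / K ^ 3 * (2 * (κ ^ 4 * K ^ 4)) := by
          rw [hC₃]; field_simp
        _ ≤ _ := by gcongr
    refine this.trans ?_
    gcongr
    linarith only [hC₁0, hC₂0]

lemma abs_discSum_le_of_decay {T : ℤ → ℤ → ℝ} {C : ℝ} {m K : ℕ} (hm : 1 ≤ m) (hK : 1 ≤ K)
    (hC : 0 ≤ C) (hsymm : ∀ i j, T i j = T j i) (hper : ∀ i j, T i (j + m) = T i j)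
    (h1 : ∀ (i : ℤ) (k : ℕ), 1 ≤ k → 2 * k ≤ m → |T i (i + k)| ≤ C / m ^ 2)
    (h2 : ∀ (i : ℤ) (k : ℕ), 1 ≤ k → 2 * k ≤ m → |T i (i + k)| ≤ C / k ^ 3) :
    |discSum m T| ≤ C * (9 * K / m + m ^ 2 / K ^ 3) := by
  have hm0 : (0 : ℝ) < m := by exact_mod_cast hm
  have hK0 : (0 : ℝ) < K := by exact_mod_cast hK
  let A : ℤ → Finset ℤ := fun i => Finset.Icc (i - K) (i + K) ∪
    (Finset.Icc (i + m - K) (i + m + K) ∪ Finset.Icc (i - m - K) (i - m + K))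
  have hA : ∀ i, ((A i).card : ℝ) ≤ 9 * K := by
    intro i
    have : (A i).card ≤ 9 * K := by
      refine (Finset.card_union_le _ _).trans ?_
      have := Finset.card_union_le (Finset.Icc (i + m - K) (i + m + K))
        (Finset.Icc (i - m - K) (i - m + K))
      simp only [Int.card_Icc] at *
      omega
    exact_mod_cast this
  have key0 : ∀ (i : ℤ) (k : ℕ), 1 ≤ k → 2 * k ≤ m →
      |T i (i + k)| ≤ (if k ≤ K then C / m ^ 2 else 0) + C / K ^ 3 := by
    intro i k hk hkm
    split_ifs with h
    · exact (h1 i k hk hkm).trans (le_add_of_nonneg_right (by positivity))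
    · rw [zero_add]
      refine (h2 i k hk hkm).trans ?_
      gcongr
      omega
  have key1 : ∀ i j : ℤ, i ∈ Finset.Icc (1 : ℤ) m → j ∈ Finset.Icc (1 : ℤ) m → i < j →
      |T i j| ≤ (if j - i ≤ K ∨ m - (j - i) ≤ K then C / m ^ 2 else 0) + C / K ^ 3 := by
    intro i j hi hj hij
    rw [Finset.mem_Icc] at hi hj
    obtain ⟨k, hk⟩ : ∃ k : ℕ, j = i + k := ⟨(j - i).toNat, by omega⟩
    have hw : 0 ≤ C / (m : ℝ) ^ 2 := by positivity
    by_cases h : 2 * k ≤ m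
    · rw [hk]
      refine (key0 i k (by omega) h).trans ?_
      gcongr
      split_ifs <;> first | exact le_rfl | exact hw | omega
    · have e : T i j = T j (j + (m - k : ℕ)) := by
        rw [hsymm, ← hper]
        congr 1
        omega
      rw [e]
      refine (key0 j (m - k) (by omega) (by omega)).trans ?_
      gcongr
      split_ifs <;> first | exact le_rfl | exact hw | omega
  have key : ∀ i ∈ Finset.Icc (1 : ℤ) m, ∀ j ∈ Finset.Icc (1 : ℤ) m,
      |if i = j then 0 else T i j| ≤ (if j ∈ A i then C / m ^ 2 else 0) + C / K ^ 3 := by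
    intro i hi j hj
    have hw : 0 ≤ C / (m : ℝ) ^ 2 := by positivity
    have hv : 0 ≤ C / (K : ℝ) ^ 3 := by positivity
    have hi' := Finset.mem_Icc.1 hi
    have hj' := Finset.mem_Icc.1 hj
    rcases lt_trichotomy i j with h | h | h
    · rw [if_neg h.ne]
      refine (key1 i j hi hj h).trans ?_
      gcongr
      simp only [A, Finset.mem_union, Finset.mem_Icc]
      split_ifs <;> first | exact le_rfl | exact hw | omega
    · rw [if_pos h, abs_zero]
      split_ifs <;> positivity
    · rw [if_neg h.ne', hsymm]
      refine (key1 j i hj hi h).trans ?_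
      gcongr
      simp only [A, Finset.mem_union, Finset.mem_Icc]
      split_ifs <;> first | exact le_rfl | exact hw | omega
  have row : ∀ i ∈ Finset.Icc (1 : ℤ) m,
      |∑ j ∈ Finset.Icc (1 : ℤ) m, if i = j then 0 else T i j| ≤
        9 * K * (C / m ^ 2) + m * (C / K ^ 3) := by
    intro i hi
    refine (Finset.abs_sum_le_sum_abs _ _).trans ((Finset.sum_le_sum (key i hi)).trans ?_)
    rw [Finset.sum_add_distrib, ← Finset.sum_filter, Finset.sum_const, Finset.sum_const,
      Int.card_Icc, nsmul_eq_mul, nsmul_eq_mul]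
    have : (({j ∈ Finset.Icc (1 : ℤ) m | j ∈ A i}).card : ℝ) ≤ 9 * K := by
      refine le_trans ?_ (hA i)
      exact_mod_cast Finset.card_le_card fun j hj => (Finset.mem_filter.1 hj).2
    have e : (((m : ℤ) + 1 - 1).toNat : ℝ) = m := by simp
    rw [e]
    gcongr
  unfold discSum
  refine (Finset.abs_sum_le_sum_abs _ _).trans ((Finset.sum_le_sum row).trans ?_)
  rw [Finset.sum_const, Int.card_Icc, nsmul_eq_mul]
  have e : (((m : ℤ) + 1 - 1).toNat : ℝ) = m := by simp
  rw [e]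
  apply le_of_eq
  field_simp

theorem tendsto_discSum_zero_of_decay {T : ℕ → ℤ → ℤ → ℝ} {C : ℝ} {m₀ : ℕ} (hC : 0 ≤ C)
    (hsymm : ∀ m, m₀ ≤ m → ∀ i j, T m i j = T m j i)
    (hper : ∀ m, m₀ ≤ m → ∀ i j, T m i (j + m) = T m i j)
    (h1 : ∀ m, m₀ ≤ m → ∀ (i : ℤ) (k : ℕ), 1 ≤ k → 2 * k ≤ m → |T m i (i + k)| ≤ C / m ^ 2)
    (h2 : ∀ m, m₀ ≤ m → ∀ (i : ℤ) (k : ℕ), 1 ≤ k → 2 * k ≤ m → |T m i (i + k)| ≤ C / k ^ 3) :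
    Filter.Tendsto (fun m => discSum m (T m)) Filter.atTop (nhds 0) := by
  have lim : Filter.Tendsto (fun m : ℕ => C * 19 * (m : ℝ) ^ (-(1 / 4) : ℝ)) Filter.atTop
      (nhds 0) := by
    have h := (tendsto_rpow_neg_atTop (show (0 : ℝ) < 1 / 4 by norm_num)).comp
      tendsto_natCast_atTop_atTop
    simpa using h.const_mul (C * 19)
  refine squeeze_zero_norm' ?_ lim
  filter_upwards [Filter.eventually_ge_atTop m₀, Filter.eventually_ge_atTop 1] with m hm hm1
  have hmr : (1 : ℝ) ≤ m := by exact_mod_cast hm1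
  have hm0 : (0 : ℝ) < m := by linarith
  set x : ℝ := (m : ℝ) ^ (3 / 4 : ℝ) with hx
  have hx1 : 1 ≤ x := Real.one_le_rpow hmr (by norm_num)
  have hK1 : x ≤ ⌈x⌉₊ := Nat.le_ceil x
  have hK2 : (⌈x⌉₊ : ℝ) ≤ 2 * x := by
    linarith [Nat.ceil_lt_add_one (by linarith : 0 ≤ x)]
  have hK : 1 ≤ ⌈x⌉₊ := by
    have : (1 : ℝ) ≤ ⌈x⌉₊ := hx1.trans hK1
    exact_mod_cast this
  have := abs_discSum_le_of_decay hm1 hK hC (hsymm m hm) (hper m hm) (h1 m hm) (h2 m hm)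
  rw [Real.norm_eq_abs]
  refine this.trans ?_
  have b1 : 9 * (⌈x⌉₊ : ℝ) / m ≤ 18 * (m : ℝ) ^ (-(1 / 4) : ℝ) := by
    have e : (m : ℝ) ^ (-(1 / 4) : ℝ) = x / m := by
      rw [hx, eq_div_iff hm0.ne', ← Real.rpow_add_one hm0.ne']; norm_num
    rw [e]
    calc 9 * (⌈x⌉₊ : ℝ) / m ≤ 9 * (2 * x) / m := by gcongr
      _ = 18 * (x / m) := by ring
  have b2 : (m : ℝ) ^ 2 / (⌈x⌉₊ : ℝ) ^ 3 ≤ (m : ℝ) ^ (-(1 / 4) : ℝ) := by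
    have e : (m : ℝ) ^ (-(1 / 4) : ℝ) = (m : ℝ) ^ 2 / x ^ 3 := by
      have e3 : x ^ 3 = (m : ℝ) ^ (9 / 4 : ℝ) := by
        rw [hx, ← Real.rpow_natCast, ← Real.rpow_mul hm0.le]; norm_num
      rw [e3, ← Real.rpow_natCast, ← Real.rpow_sub hm0]
      norm_num
    rw [e]
    gcongr
  calc C * (9 * (⌈x⌉₊ : ℝ) / m + (m : ℝ) ^ 2 / (⌈x⌉₊ : ℝ) ^ 3)
      ≤ C * (18 * (m : ℝ) ^ (-(1 / 4) : ℝ) + (m : ℝ) ^ (-(1 / 4) : ℝ)) := by gcongr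
    _ = _ := by ring

/-- A closed curve of period `1` with `K`-Lipschitz derivative which is bi-Lipschitz with
constants `L₁ ≤ L₂` with respect to the distance of `ℝ/ℤ`. -/
structure BiLipschitzLoop {E : Type*} [NormedAddCommGroup E] [NormedSpace ℝ E] (f : ℝ → E)
    (K L₁ L₂ : ℝ) : Prop where
  periodic : ∀ x, f (x + 1) = f x
  hasDerivAt : ∀ x, HasDerivAt f (deriv f x) x
  nonneg : 0 ≤ K
  lipschitz : ∀ x y, ‖deriv f x - deriv f y‖ ≤ K * |x - y|
  pos : 0 < L₁
  le : L₁ ≤ L₂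
  lower : ∀ a b, a ≤ b → b ≤ a + 1 → L₁ * min (b - a) (1 - (b - a)) ≤ ‖f b - f a‖
  upper : ∀ a b, a ≤ b → b ≤ a + 1 → ‖f b - f a‖ ≤ L₂ * min (b - a) (1 - (b - a))

/-- Parameters `θ` of an equilateral polygon with `m` edges of length `h` inscribed in `f`. -/
structure EquilateralParam {E : Type*} [NormedAddCommGroup E] (f : ℝ → E)
    (θ : ℤ → ℝ) (m : ℕ) (h : ℝ) : Prop where
  strictMono : StrictMono θ
  periodic : ∀ i, θ (i + m) = θ i + 1
  edge_eq : ∀ i, ‖f (θ (i + 1)) - f (θ i)‖ = h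

lemma circleDist_eq_min {a b : ℝ} (h : a ≤ b) (h' : b ≤ a + 1) :
    circleDist b a = min (b - a) (1 - (b - a)) := by
  unfold circleDist
  rcases h'.lt_or_eq with h1 | h1
  · rw [Int.fract_eq_self.2 ⟨by linarith, by linarith⟩]
  · have e : b - a = 1 := by linarith
    simp [e]

namespace BiLipschitzLoop

variable {E : Type*} [NormedAddCommGroup E] [NormedSpace ℝ E] {f : ℝ → E} {K L₁ L₂ : ℝ}

lemma pos₂ (hf : BiLipschitzLoop f K L₁ L₂) : 0 < L₂ := hf.pos.trans_le hf.le

lemma norm_taylor_le (hf : BiLipschitzLoop f K L₁ L₂) (a b : ℝ) :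
    ‖f b - f a - (b - a) • deriv f a‖ ≤ K * (b - a) ^ 2 := by
  have h := (convex_uIcc a b).norm_image_sub_le_of_norm_hasDerivWithin_le
    (f := fun x => f x - (x - a) • deriv f a) (f' := fun x => deriv f x - deriv f a)
    (C := K * |b - a|) (x := a) (y := b) (fun x _ => by
      have h1 := ((hasDerivAt_id x).sub_const a).smul_const (deriv f a)
      rw [one_smul] at h1
      exact ((hf.hasDerivAt x).sub h1).hasDerivWithinAt) (fun x hx => by
      refine (hf.lipschitz x a).trans ?_
      exact mul_le_mul_of_nonneg_left (Set.abs_sub_left_of_mem_uIcc hx) hf.nonneg) Set.left_mem_uIcc Set.right_mem_uIcc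
  rw [Real.norm_eq_abs, mul_assoc, abs_mul_abs_self] at h
  calc _ = ‖f b - (b - a) • deriv f a - (f a - (a - a) • deriv f a)‖ := by
        congr 1; simp; abel
    _ ≤ _ := h.trans_eq (by ring)

lemma norm_deriv_bounds (hf : BiLipschitzLoop f K L₁ L₂) (x : ℝ) :
    L₁ ≤ ‖deriv f x‖ ∧ ‖deriv f x‖ ≤ L₂ := by
  have h : Filter.Tendsto (fun y => ‖slope f x y‖) (nhdsWithin x (Set.Ioi x))
      (nhds ‖deriv f x‖) :=
    (hasDerivAt_iff_tendsto_slope.1 (hf.hasDerivAt x)).norm.mono_left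
      (nhdsWithin_mono x (fun y (hy : x < y) => hy.ne'))
  have ev : ∀ᶠ y in nhdsWithin x (Set.Ioi x), L₁ ≤ ‖slope f x y‖ ∧ ‖slope f x y‖ ≤ L₂ := by
    filter_upwards [Ioo_mem_nhdsGT (show x < x + 1 / 2 by linarith)] with y hy
    have hs : 0 < y - x := sub_pos.2 hy.1
    have e : min (y - x) (1 - (y - x)) = y - x := min_eq_left (by linarith [hy.2])
    have h1 := hf.lower x y hy.1.le (by linarith [hy.2])
    have h2 := hf.upper x y hy.1.le (by linarith [hy.2])
    rw [e] at h1 h2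
    rw [slope_def_module, norm_smul, norm_inv, Real.norm_eq_abs, abs_of_pos hs,
      ← div_eq_inv_mul]
    exact ⟨(le_div_iff₀ hs).2 h1, (div_le_iff₀ hs).2 h2⟩
  exact ⟨ge_of_tendsto h (ev.mono fun _ h => h.1), le_of_tendsto h (ev.mono fun _ h => h.2)⟩

lemma deriv_add_one (hf : BiLipschitzLoop f K L₁ L₂) (x : ℝ) :
    deriv f (x + 1) = deriv f x := by
  rw [← deriv_comp_add_const]
  congr 1
  exact funext hf.periodic

end BiLipschitzLoop

lemma EquilateralParam.le_add_one {E : Type*} [NormedAddCommGroup E] {f : ℝ → E} {θ : ℤ → ℝ}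
    {m : ℕ} {h : ℝ} (hθ : EquilateralParam f θ m h) (hm : 1 ≤ m) (i : ℤ) :
    θ (i + 1) ≤ θ i + 1 := by
  rw [← hθ.periodic]
  exact hθ.strictMono.monotone (by omega)

namespace EquilateralParam

variable {E : Type*} [NormedAddCommGroup E] [NormedSpace ℝ E] {f : ℝ → E} {K L₁ L₂ h : ℝ}
  {θ : ℤ → ℝ} {m : ℕ}

lemma two_le (hf : BiLipschitzLoop f K L₁ L₂) (hm : L₂ < L₁ * (m - 1)) : 2 ≤ m := by
  have h1 : L₁ * 1 < L₁ * (m - 1) := by linarith [hf.le]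
  have h2 := lt_of_mul_lt_mul_left h1 hf.pos.le
  have h3 : (1 : ℝ) < m := by linarith
  exact_mod_cast h3

lemma pos (hf : BiLipschitzLoop f K L₁ L₂) (hθ : EquilateralParam f θ m h)
    (hm : L₂ < L₁ * (m - 1)) : 0 < h := by
  have h2 := two_le hf hm
  have h3 : θ 0 < θ (0 + 1) := hθ.strictMono (by omega)
  have h4 : θ (0 + 1) < θ 0 + 1 := by
    rw [← hθ.periodic]
    exact hθ.strictMono (by omega)
  have := hf.lower _ _ h3.le h4.le
  rw [hθ.edge_eq] at this
  exact (mul_pos hf.pos (lt_min (by linarith) (by linarith))).trans_le this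

lemma le_mul_sub (hf : BiLipschitzLoop f K L₁ L₂) (hθ : EquilateralParam f θ m h)
    (hm : 1 ≤ m) (i : ℤ) (k : ℕ) : k * h ≤ L₂ * (θ (i + k) - θ i) := by
  induction k with
  | zero => simp
  | succ k ih =>
    have h1 := hf.upper _ _ (hθ.strictMono.monotone (by omega : i + k ≤ i + k + 1))
      (hθ.le_add_one hm _)
    rw [hθ.edge_eq] at h1
    have h2 := h1.trans (mul_le_mul_of_nonneg_left (min_le_left _ _) hf.pos₂.le)
    have e : i + ((k + 1 : ℕ) : ℤ) = i + k + 1 := by push_cast; ring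
    rw [e]
    push_cast
    linarith

lemma step_bounds (hf : BiLipschitzLoop f K L₁ L₂) (hθ : EquilateralParam f θ m h)
    (hm : L₂ < L₁ * (m - 1)) (i : ℤ) :
    0 < θ (i + 1) - θ i ∧ θ (i + 1) - θ i ≤ 1 / 2 ∧ L₁ * (θ (i + 1) - θ i) ≤ h := by
  have h2 := two_le hf hm
  have hh := hθ.pos hf hm
  have h3 : θ i < θ (i + 1) := hθ.strictMono (by omega)
  have h4 := hf.lower _ _ h3.le (hθ.le_add_one (by omega) i)
  rw [hθ.edge_eq] at h4
  by_cases hs : θ (i + 1) - θ i ≤ 1 / 2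
  · rw [min_eq_left (by linarith)] at h4
    exact ⟨by linarith, hs, h4⟩
  · rw [min_eq_right (by linarith)] at h4
    have h5 := hθ.le_mul_sub hf (by omega) (i + 1) (m - 1)
    have e : i + 1 + ((m - 1 : ℕ) : ℤ) = i + m := by omega
    rw [e, hθ.periodic, Nat.cast_sub (by omega)] at h5
    push_cast at h5
    have h6 : L₁ * ((m - 1) * h) ≤ L₂ * h := by
      calc L₁ * ((m - 1) * h) ≤ L₁ * (L₂ * (θ i + 1 - θ (i + 1))) :=
            mul_le_mul_of_nonneg_left h5 hf.pos.le
        _ = L₂ * (L₁ * (1 - (θ (i + 1) - θ i))) := by ring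
        _ ≤ _ := mul_le_mul_of_nonneg_left h4 hf.pos₂.le
    have h7 := mul_lt_mul_of_pos_right hm hh
    linarith

lemma mul_sub_le (hf : BiLipschitzLoop f K L₁ L₂) (hθ : EquilateralParam f θ m h)
    (hm : L₂ < L₁ * (m - 1)) (i : ℤ) (k : ℕ) : L₁ * (θ (i + k) - θ i) ≤ k * h := by
  induction k with
  | zero => simp
  | succ k ih =>
    have h1 := (hθ.step_bounds hf hm (i + k)).2.2
    have e : i + ((k + 1 : ℕ) : ℤ) = i + k + 1 := by push_cast; ring
    rw [e]
    push_cast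
    linarith

lemma edge_bounds (hf : BiLipschitzLoop f K L₁ L₂) (hθ : EquilateralParam f θ m h)
    (hm : L₂ < L₁ * (m - 1)) : L₁ ≤ m * h ∧ m * h ≤ L₂ := by
  have h2 := two_le hf hm
  have h1 := hθ.le_mul_sub hf (by omega) 0 m
  have h3 := hθ.mul_sub_le hf hm 0 m
  rw [hθ.periodic] at h1 h3
  constructor <;> linarith

lemma le_norm_chord (hf : BiLipschitzLoop f K L₁ L₂) (hθ : EquilateralParam f θ m h)
    (hm : L₂ < L₁ * (m - 1)) (i : ℤ) (k : ℕ) (hkm : 2 * k ≤ m) :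
    L₁ / L₂ * k * h ≤ ‖f (θ (i + k)) - f (θ i)‖ := by
  have h2 := two_le hf hm
  have hh := hθ.pos hf hm
  have h1 := hθ.le_mul_sub hf (by omega) i k
  have h3 := hθ.le_mul_sub hf (by omega) (i + k) (m - k)
  have e : i + k + ((m - k : ℕ) : ℤ) = i + m := by omega
  rw [e, hθ.periodic] at h3
  have h4 : (k : ℝ) * h ≤ ((m - k : ℕ) : ℝ) * h := by
    gcongr
    omega
  have hle : θ (i + k) ≤ θ i + 1 := by
    rw [← hθ.periodic]
    exact hθ.strictMono.monotone (by omega)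
  refine le_trans ?_ (hf.lower _ _ (hθ.strictMono.monotone (by omega)) hle)
  rw [mul_assoc, div_mul_eq_mul_div, mul_div_assoc]
  refine mul_le_mul_of_nonneg_left (le_min ?_ ?_) hf.pos.le <;> rw [div_le_iff₀ hf.pos₂] <;>
    linarith

lemma norm_unit_edge_sub_le (hf : BiLipschitzLoop f K L₁ L₂) (hθ : EquilateralParam f θ m h)
    (hm : L₂ < L₁ * (m - 1)) (i : ℤ) :
    ‖h⁻¹ • (f (θ (i + 1 + 1)) - f (θ (i + 1))) - h⁻¹ • (f (θ (i + 1)) - f (θ i))‖ ≤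
      4 * K * L₂ / L₁ ^ 2 / m := by
  have hh := hθ.pos hf hm
  have h2 := two_le hf hm
  have hm0 : (0 : ℝ) < m := by exact_mod_cast (by omega : 0 < m)
  have hb := (hθ.edge_bounds hf hm).2
  set t := deriv f (θ (i + 1)) with ht
  have htn : L₁ ≤ ‖t‖ := (hf.norm_deriv_bounds _).1
  have hK := hf.nonneg
  have hL := hf.pos
  have key : ∀ (δ : ℝ) (v : E), 0 < δ → L₁ * δ ≤ h → ‖v‖ = h → ‖v - δ • t‖ ≤ K * δ ^ 2 →
      ‖h⁻¹ • v - ‖t‖⁻¹ • t‖ ≤ 2 * K * L₂ / L₁ ^ 2 / m := by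
    intro δ v hδ h1 hv h3
    have ht0 : 0 < ‖t‖ := hL.trans_le htn
    have h4 := norm_normalize_sub_le v (δ • t) (smul_ne_zero hδ.ne' (norm_pos_iff.1 ht0))
    have e : ‖δ • t‖⁻¹ • δ • t = ‖t‖⁻¹ • t := by
      rw [norm_smul, Real.norm_eq_abs, abs_of_pos hδ, smul_smul]
      congr 1
      field_simp
    rw [e, hv, norm_smul, Real.norm_eq_abs, abs_of_pos hδ] at h4
    refine h4.trans ?_
    have h5 : δ ≤ L₂ / L₁ / m := by
      rw [div_div, le_div_iff₀ (by positivity)]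
      nlinarith
    calc 2 * ‖v - δ • t‖ / (δ * ‖t‖) ≤ 2 * (K * δ ^ 2) / (δ * L₁) := by gcongr
      _ = 2 * K / L₁ * δ := by field_simp
      _ ≤ 2 * K / L₁ * (L₂ / L₁ / m) := by gcongr
      _ = _ := by field_simp
  have k1 := key _ _ (hθ.step_bounds hf hm (i + 1)).1 (hθ.step_bounds hf hm (i + 1)).2.2
    (hθ.edge_eq (i + 1)) (hf.norm_taylor_le _ _)
  have k2 := key _ _ (hθ.step_bounds hf hm i).1 (hθ.step_bounds hf hm i).2.2
    (hθ.edge_eq i) (by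
      have := hf.norm_taylor_le (θ (i + 1)) (θ i)
      rw [← norm_neg] at this
      calc _ = ‖-(f (θ i) - f (θ (i + 1)) - (θ i - θ (i + 1)) • deriv f (θ (i + 1)))‖ := by
            congr 1
            rw [ht, sub_smul, sub_smul]
            abel
        _ ≤ _ := this.trans_eq (by ring))
  calc _ ≤ _ := norm_sub_le_norm_sub_add_norm_sub _ (‖t‖⁻¹ • t) _
    _ ≤ 2 * K * L₂ / L₁ ^ 2 / m + 2 * K * L₂ / L₁ ^ 2 / m := by
        rw [norm_sub_rev (‖t‖⁻¹ • t)]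
        gcongr
    _ = _ := by ring

end EquilateralParam

section

/-- The principal density of the Möbius energy at two points joined by the chord `c` and having
velocities `u` and `v`. -/
def principalDensity {E : Type*} [NormedAddCommGroup E] [InnerProductSpace ℝ E] (u v c : E) : ℝ :=
  (‖u‖ * ‖v‖ + ⟪u, v⟫) / ‖c‖ ^ 2 - 2 * (⟪c, u⟫ * ⟪c, v⟫) / ‖c‖ ^ 4

section

variable {E : Type*} [NormedAddCommGroup E] [InnerProductSpace ℝ E]

lemma principalDensity_comm (u v c : E) : principalDensity u v c = principalDensity v u (-c) := by
  unfold principalDensity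
  rw [norm_neg, inner_neg_left, inner_neg_left, real_inner_comm]
  ring

lemma principalDensity_smul {p q r : ℝ} (hp : 0 ≤ p) (hq : 0 ≤ q) (hr : r ≠ 0) (u v c : E) :
    principalDensity (p • u) (q • v) (r • c) = p * q / r ^ 2 * principalDensity u v c := by
  unfold principalDensity
  simp only [norm_smul, real_inner_smul_left, real_inner_smul_right, Real.norm_eq_abs, abs_of_nonneg hp,
    abs_of_nonneg hq, mul_pow, sq_abs]
  have e : |r| ^ 4 = r ^ 4 := by
    rw [show 4 = 2 * 2 by norm_num, pow_mul, pow_mul, sq_abs]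
  rw [e]
  by_cases hc : ‖c‖ = 0
  · simp [hc]
  · field_simp

end

variable {n : ℕ}

lemma dOp_sq_chn (f : ℝ → EuclideanSpace ℝ (Fin n)) (θ : ℤ → ℝ) (i j : ℤ) :
    dOpI (dOpJ (fun a b => chn f θ a b ^ 2)) i j = -2 * ⟪edge f θ i, edge f θ j⟫ := by
  unfold dOpI dOpJ chn
  have e1 : chord f θ (i + 1) (j + 1) = chord f θ i j + edge f θ j - edge f θ i := by
    unfold chord edge; abel
  have e2 : chord f θ (i + 1) j = chord f θ i j - edge f θ i := by
    unfold chord edge; abel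
  have e3 : chord f θ i (j + 1) = chord f θ i j + edge f θ j := by
    unfold chord edge; abel
  beta_reduce
  rw [e1, e2, e3]
  simp only [← real_inner_self_eq_norm_sq, inner_add_left, inner_add_right, inner_sub_left,
    inner_sub_right]
  rw [real_inner_comm (edge f θ i) (edge f θ j)]
  ring

/-- The discrete principal density of a polygon inscribed in `f`. -/
def discPrincipal (f : ℝ → EuclideanSpace ℝ (Fin n)) (θ : ℤ → ℝ) (i j : ℤ) : ℝ :=
  principalDensity (edge f θ i) (edge f θ j) (chord f θ i j)

lemma discPrincipal_eq (f : ℝ → EuclideanSpace ℝ (Fin n)) (θ : ℤ → ℝ) (i j : ℤ)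
    (hi : ‖edge f θ i‖ ≠ 0) (hj : ‖edge f θ j‖ ≠ 0) :
    ((‖edge f θ i‖ * ‖edge f θ j‖) / chn f θ i j ^ 2) *
      (1 - (1 / (2 * (‖edge f θ i‖ * ‖edge f θ j‖))) *
        (dOpI (dOpJ (fun a b => chn f θ a b ^ 2)) i j +
          4 * (⟪chord f θ i j, edge f θ i⟫ * ⟪chord f θ i j, edge f θ j⟫) /
            chn f θ i j ^ 2)) = discPrincipal f θ i j := by
  rw [dOp_sq_chn]
  unfold discPrincipal principalDensity chn
  by_cases hc : ‖chord f θ i j‖ = 0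
  · simp [hc]
  · field_simp
    ring

/-- The discrete Möbius energy density of the cosine formula. -/
def discMobius (f : ℝ → EuclideanSpace ℝ (Fin n)) (θ : ℤ → ℝ) (i j : ℤ) : ℝ :=
  (1 / crossRatio f θ i j) *
    (1 - (1 / 2) * dOpI (dOpJ (crossRatio f θ)) i j +
      (1 / (2 * crossRatio f θ i j)) *
        (dOpI (crossRatio f θ) i j * dOpJ (crossRatio f θ) i j - 1))

lemma chn_comm (f : ℝ → EuclideanSpace ℝ (Fin n)) (θ : ℤ → ℝ) (i j : ℤ) :
    chn f θ i j = chn f θ j i := norm_sub_rev _ _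

lemma crossRatio_comm (f : ℝ → EuclideanSpace ℝ (Fin n)) (θ : ℤ → ℝ) (i j : ℤ) :
    crossRatio f θ i j = crossRatio f θ j i := by
  unfold crossRatio
  rw [chn_comm f θ i j, chn_comm f θ (i + 1) (j + 1), mul_comm ‖edge f θ i‖]

lemma discMobius_comm (f : ℝ → EuclideanSpace ℝ (Fin n)) (θ : ℤ → ℝ) (i j : ℤ) :
    discMobius f θ i j = discMobius f θ j i := by
  unfold discMobius dOpI dOpJ
  rw [crossRatio_comm f θ i j, crossRatio_comm f θ (i + 1) (j + 1),
    crossRatio_comm f θ (i + 1) j, crossRatio_comm f θ i (j + 1)]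
  ring

lemma discPrincipal_comm (f : ℝ → EuclideanSpace ℝ (Fin n)) (θ : ℤ → ℝ) (i j : ℤ) :
    discPrincipal f θ i j = discPrincipal f θ j i := by
  unfold discPrincipal
  rw [principalDensity_comm]
  congr 1
  exact neg_sub _ _

section periodic

variable {f : ℝ → EuclideanSpace ℝ (Fin n)} {θ : ℤ → ℝ} {m : ℕ}

lemma edge_add_period (hf : ∀ x, f (x + 1) = f x) (hθ : ∀ i, θ (i + m) = θ i + 1) (i : ℤ) :
    edge f θ (i + m) = edge f θ i := by
  unfold edge
  rw [add_right_comm, hθ, hθ, hf, hf]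

lemma chord_add_period (hf : ∀ x, f (x + 1) = f x) (hθ : ∀ i, θ (i + m) = θ i + 1) (i j : ℤ) :
    chord f θ i (j + m) = chord f θ i j := by
  unfold chord
  rw [hθ, hf]

lemma crossRatio_add_period (hf : ∀ x, f (x + 1) = f x) (hθ : ∀ i, θ (i + m) = θ i + 1)
    (i j : ℤ) : crossRatio f θ i (j + m) = crossRatio f θ i j := by
  unfold crossRatio chn
  rw [edge_add_period hf hθ, add_right_comm, chord_add_period hf hθ, chord_add_period hf hθ]

lemma discMobius_add_period (hf : ∀ x, f (x + 1) = f x) (hθ : ∀ i, θ (i + m) = θ i + 1)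
    (i j : ℤ) : discMobius f θ i (j + m) = discMobius f θ i j := by
  unfold discMobius dOpI dOpJ
  rw [add_right_comm j]
  simp only [crossRatio_add_period hf hθ]

lemma discPrincipal_add_period (hf : ∀ x, f (x + 1) = f x) (hθ : ∀ i, θ (i + m) = θ i + 1)
    (i j : ℤ) : discPrincipal f θ i (j + m) = discPrincipal f θ i j := by
  unfold discPrincipal
  rw [edge_add_period hf hθ, chord_add_period hf hθ]

end periodic

lemma discMobius_eq (f : ℝ → EuclideanSpace ℝ (Fin n)) (θ : ℤ → ℝ) (i j : ℤ)
    (h : crossRatio f θ i j ≠ 0) :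
    discMobius f θ i j = (2 * crossRatio f θ i j -
      crossRatio f θ i j * crossRatio f θ (i + 1) (j + 1) +
      crossRatio f θ (i + 1) j * crossRatio f θ i (j + 1) - 1) /
        (2 * crossRatio f θ i j ^ 2) := by
  unfold discMobius dOpI dOpJ
  field_simp
  ring

theorem disc_density_bounds {f : ℝ → EuclideanSpace ℝ (Fin n)} {K L₁ L₂ : ℝ}
    (hf : BiLipschitzLoop f K L₁ L₂) :
    ∃ C, 0 ≤ C ∧ ∀ (θ : ℤ → ℝ) (m : ℕ) (h : ℝ), EquilateralParam f θ m h →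
      L₂ < L₁ * (m - 1) → ∀ (i : ℤ) (k : ℕ), 1 ≤ k → 2 * k ≤ m →
      |discPrincipal f θ i (i + k)| ≤ C / m ^ 2 ∧
      |discMobius f θ i (i + k) - discPrincipal f θ i (i + k)| ≤ C / m ^ 2 ∧
      |discMobius f θ i (i + k) - discPrincipal f θ i (i + k)| ≤ C / k ^ 3 := by
  have hκ : 0 < L₁ / L₂ := div_pos hf.pos hf.pos₂
  set C₁ := 4 * K * L₂ / L₁ ^ 2 with hC₁
  have hC₁0 : 0 ≤ C₁ := by
    have := hf.nonneg
    have := hf.pos₂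
    positivity
  obtain ⟨C, hC⟩ := unit_polygon_density_bounds (E := EuclideanSpace ℝ (Fin n)) (Λ := C₁) hκ
  refine ⟨max C 0 * C₁ ^ 2 + max C 0, by positivity, ?_⟩
  intro θ m h hθ hm i k hk hkm
  have hh := hθ.pos hf hm
  have h2 := EquilateralParam.two_le hf hm
  have hm0 : (0 : ℝ) < m := by exact_mod_cast (by omega : 0 < m)
  have hk0 : (0 : ℝ) < k := by exact_mod_cast (by omega : 0 < k)
  set X : ℤ → EuclideanSpace ℝ (Fin n) := fun i => h⁻¹ • f (θ i) with hX
  have hXc : ∀ i j, X j - X i = h⁻¹ • chord f θ i j := fun i j => (smul_sub _ _ _).symm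
  have hXn : ∀ i j, ‖X j - X i‖ = chn f θ i j / h := fun i j => by
    rw [hXc, norm_smul, norm_inv, Real.norm_eq_abs, abs_of_pos hh, ← div_eq_inv_mul, chn]
  have hen : ∀ i, ‖edge f θ i‖ = h := hθ.edge_eq
  have hcr : ∀ i j, crossRatio f θ i j = ‖X j - X i‖ * ‖X (j + 1) - X (i + 1)‖ := fun i j => by
    rw [hXn, hXn, crossRatio, hen, hen]
    field_simp
  have hlow : ∀ i : ℤ, L₁ / L₂ * k ≤ ‖X (i + k) - X i‖ := fun i => by
    rw [hXn, le_div_iff₀ hh]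
    exact hθ.le_norm_chord hf hm i k hkm
  have e1 : i + (k : ℤ) + 1 = i + 1 + k := by ring
  have e2 : i + (k : ℤ) + 1 + 1 = i + 1 + 1 + k := by ring
  have l0 := hlow i
  have l1 := hlow (i + 1)
  have l2 := hlow (i + 1 + 1)
  rw [← e1] at l1
  rw [← e2] at l2
  obtain ⟨b1, b2, b3⟩ := hC X (fun i => h⁻¹ • edge f θ i) (C₁ / m) (fun i => hXc i (i + 1))
    (fun i => by
      rw [norm_smul, hen, norm_inv, Real.norm_eq_abs, abs_of_pos hh, inv_mul_cancel₀ hh.ne'])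
    (fun i => hθ.norm_unit_edge_sub_le hf hm i) i (i + k) k rfl hk (by
      rw [div_mul_eq_mul_div, div_le_iff₀ hm0]
      gcongr
      omega) l0 l1 l2 _ _ _ _ _ _ _ (discPrincipal f θ i (i + k)) rfl rfl rfl rfl rfl rfl rfl (by
      have e := principalDensity_smul (inv_nonneg.2 hh.le) (inv_nonneg.2 hh.le)
        (inv_ne_zero hh.ne') (edge f θ i) (edge f θ (i + k)) (chord f θ i (i + k))
      have e' : h⁻¹ * h⁻¹ / h⁻¹ ^ 2 = 1 := by
        field_simp
      rw [e', one_mul, ← hXc] at e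
      rw [discPrincipal, ← e, principalDensity, norm_smul, norm_smul, hen, hen, norm_inv,
        Real.norm_eq_abs, abs_of_pos hh, inv_mul_cancel₀ hh.ne']
      have hne : ‖X (i + k) - X i‖ ≠ 0 := (lt_of_lt_of_le (by positivity) l0).ne'
      field_simp)
  have hne : crossRatio f θ i (i + k) ≠ 0 := by
    rw [hcr]
    exact (mul_pos (lt_of_lt_of_le (by positivity) l0) (lt_of_lt_of_le (by positivity) l1)).ne'
  rw [← hcr, ← hcr, ← hcr, ← hcr, ← discMobius_eq _ _ _ _ hne] at b2 b3
  have c1 : C * (C₁ / m) ^ 2 ≤ (max C 0 * C₁ ^ 2 + max C 0) / m ^ 2 := by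
    rw [div_pow, ← mul_div_assoc]
    have : C * C₁ ^ 2 ≤ max C 0 * C₁ ^ 2 := by gcongr; exact le_max_left _ _
    gcongr
    linarith [le_max_right C 0]
  refine ⟨b1.trans c1, b2.trans c1, b3.trans ?_⟩
  have : 0 ≤ max C 0 * C₁ ^ 2 := by positivity
  gcongr
  linarith [le_max_left C 0]

end

section

variable {E : Type*} [NormedAddCommGroup E] [InnerProductSpace ℝ E]

lemma principalDensity_eq_div (u v c : E) :
    principalDensity u v c =
      (‖u‖ * ‖v‖ + ⟪u, v⟫ - 2 * (⟪‖c‖⁻¹ • c, u⟫ * ⟪‖c‖⁻¹ • c, v⟫)) / ‖c‖ ^ 2 := by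
  unfold principalDensity
  rw [real_inner_smul_left, real_inner_smul_left]
  by_cases hc : ‖c‖ = 0
  · simp [hc]
  · field_simp

lemma abs_principalDensity_sub_le {u v c u' v' c' : E} {B ρ : ℝ} (hρ : 0 < ρ)
    (hu : ‖u‖ ≤ B) (hv : ‖v‖ ≤ B) (hu' : ‖u'‖ ≤ B) (hv' : ‖v'‖ ≤ B)
    (hc : ρ ≤ ‖c‖) (hc' : ρ ≤ ‖c'‖) :
    |principalDensity u v c - principalDensity u' v' c'| ≤
      4 * B * (‖u - u'‖ + ‖v - v'‖) / ρ ^ 2 + 16 * B ^ 2 * ‖c - c'‖ / ρ ^ 3 := by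
  have hB : 0 ≤ B := (norm_nonneg u).trans hu
  have hc0 : 0 < ‖c‖ := hρ.trans_le hc
  have hc0' : 0 < ‖c'‖ := hρ.trans_le hc'
  set w := ‖c‖⁻¹ • c with hw
  set w' := ‖c'‖⁻¹ • c' with hw'
  have hwn : ‖w‖ = 1 := by
    rw [hw, norm_smul, norm_inv, norm_norm, inv_mul_cancel₀ hc0.ne']
  have hwn' : ‖w'‖ = 1 := by
    rw [hw', norm_smul, norm_inv, norm_norm, inv_mul_cancel₀ hc0'.ne']
  have hww : ‖w - w'‖ ≤ 2 * ‖c - c'‖ / ρ :=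
    (norm_normalize_sub_le c c' (norm_pos_iff.1 hc0')).trans (by gcongr)
  have hA : ∀ x y x' y' : E, ‖y‖ ≤ B → ‖x'‖ ≤ B →
      |‖x‖ * ‖y‖ - ‖x'‖ * ‖y'‖| ≤ B * (‖x - x'‖ + ‖y - y'‖) := by
    intro x y x' y' hy hx'
    have e : ‖x‖ * ‖y‖ - ‖x'‖ * ‖y'‖ = (‖x‖ - ‖x'‖) * ‖y‖ + ‖x'‖ * (‖y‖ - ‖y'‖) := by ring
    rw [e]
    refine (abs_add_le _ _).trans ?_
    rw [abs_mul, abs_mul, abs_norm, abs_norm]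
    calc _ ≤ ‖x - x'‖ * B + B * ‖y - y'‖ := by
          gcongr <;> exact abs_norm_sub_norm_le _ _
      _ = _ := by ring
  have hI : |⟪u, v⟫ - ⟪u', v'⟫| ≤ B * (‖u - u'‖ + ‖v - v'‖) := by
    have e : ⟪u, v⟫ - ⟪u', v'⟫ = ⟪u - u', v⟫ + ⟪u', v - v'⟫ := by
      rw [inner_sub_left, inner_sub_right]; ring
    rw [e]
    refine (abs_add_le _ _).trans ?_
    calc _ ≤ ‖u - u'‖ * ‖v‖ + ‖u'‖ * ‖v - v'‖ := by
          gcongr <;> exact abs_real_inner_le_norm _ _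
      _ ≤ ‖u - u'‖ * B + B * ‖v - v'‖ := by gcongr
      _ = _ := by ring
  have hJ : ∀ x x' : E, ‖x‖ ≤ B → |⟪w, x⟫ - ⟪w', x'⟫| ≤ B * ‖w - w'‖ + ‖x - x'‖ := by
    intro x x' hx
    have e : ⟪w, x⟫ - ⟪w', x'⟫ = ⟪w - w', x⟫ + ⟪w', x - x'⟫ := by
      rw [inner_sub_left, inner_sub_right]; ring
    rw [e]
    refine (abs_add_le _ _).trans ?_
    calc _ ≤ ‖w - w'‖ * ‖x‖ + ‖w'‖ * ‖x - x'‖ := by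
          gcongr <;> exact abs_real_inner_le_norm _ _
      _ ≤ ‖w - w'‖ * B + 1 * ‖x - x'‖ := by rw [hwn']; gcongr
      _ = _ := by ring
  have hb : ∀ w x : E, ‖w‖ = 1 → ‖x‖ ≤ B → |⟪w, x⟫| ≤ B := fun w x hw hx =>
    (abs_real_inner_le_norm _ _).trans (by rw [hw, one_mul]; exact hx)
  have hP : |⟪w, u⟫ * ⟪w, v⟫ - ⟪w', u'⟫ * ⟪w', v'⟫| ≤
      B * (‖u - u'‖ + ‖v - v'‖) + 2 * B ^ 2 * ‖w - w'‖ := by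
    have e : ⟪w, u⟫ * ⟪w, v⟫ - ⟪w', u'⟫ * ⟪w', v'⟫ =
      (⟪w, u⟫ - ⟪w', u'⟫) * ⟪w, v⟫ + ⟪w', u'⟫ * (⟪w, v⟫ - ⟪w', v'⟫) := by ring
    rw [e]
    refine (abs_add_le _ _).trans ?_
    rw [abs_mul, abs_mul]
    calc _ ≤ (B * ‖w - w'‖ + ‖u - u'‖) * B + B * (B * ‖w - w'‖ + ‖v - v'‖) := by
          gcongr
          exacts [hJ _ _ hu, hb _ _ hwn hv, hb _ _ hwn' hu', hJ _ _ hv]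
      _ = _ := by ring
  set N := ‖u‖ * ‖v‖ + ⟪u, v⟫ - 2 * (⟪w, u⟫ * ⟪w, v⟫) with hN
  set N' := ‖u'‖ * ‖v'‖ + ⟪u', v'⟫ - 2 * (⟪w', u'⟫ * ⟪w', v'⟫) with hN'
  have hNN : |N - N'| ≤ 4 * B * (‖u - u'‖ + ‖v - v'‖) + 4 * B ^ 2 * ‖w - w'‖ := by
    have h1 := abs_le.1 (hA u v u' v' hv hu')
    have h2 := abs_le.1 hI
    have h3 := abs_le.1 hP
    rw [abs_le]
    constructor <;> linarith only [h1.1, h1.2, h2.1, h2.2, h3.1, h3.2, hN, hN']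
  have hNb : |N'| ≤ 4 * B ^ 2 := by
    have h1 : ‖u'‖ * ‖v'‖ ≤ B * B := by gcongr
    have h0 : 0 ≤ ‖u'‖ * ‖v'‖ := by positivity
    have h2 := abs_le.1 ((abs_real_inner_le_norm u' v').trans h1)
    have h3 : |⟪w', u'⟫ * ⟪w', v'⟫| ≤ B * B := by
      rw [abs_mul]
      have := hb _ _ hwn' hu'
      have := hb _ _ hwn' hv'
      gcongr
    have h3 := abs_le.1 h3
    rw [abs_le]
    constructor <;> linarith only [h1, h0, h2.1, h2.2, h3.1, h3.2, hN']
  have hcc : |1 / ‖c‖ ^ 2 - 1 / ‖c'‖ ^ 2| ≤ 2 * ‖c - c'‖ / ρ ^ 3 := by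
    have e : 1 / ‖c‖ ^ 2 - 1 / ‖c'‖ ^ 2 =
        (‖c'‖ - ‖c‖) * (1 / (‖c‖ * ‖c'‖ ^ 2) + 1 / (‖c‖ ^ 2 * ‖c'‖)) := by
      field_simp
      ring
    have hp : 0 ≤ 1 / (‖c‖ * ‖c'‖ ^ 2) + 1 / (‖c‖ ^ 2 * ‖c'‖) := by positivity
    rw [e, abs_mul, abs_of_nonneg hp]
    calc _ ≤ ‖c - c'‖ * (1 / (ρ * ρ ^ 2) + 1 / (ρ ^ 2 * ρ)) := by
          gcongr
          rw [norm_sub_rev]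
          exact abs_norm_sub_norm_le _ _
      _ = _ := by field_simp; ring
  rw [principalDensity_eq_div, principalDensity_eq_div]
  have e : N / ‖c‖ ^ 2 - N' / ‖c'‖ ^ 2 =
    (N - N') / ‖c‖ ^ 2 + N' * (1 / ‖c‖ ^ 2 - 1 / ‖c'‖ ^ 2) := by field_simp; ring
  rw [← hw, ← hw', ← hN, ← hN', e]
  refine (abs_add_le _ _).trans ?_
  rw [abs_div, abs_mul, abs_of_pos (pow_pos hc0 2)]
  calc _ ≤ (4 * B * (‖u - u'‖ + ‖v - v'‖) + 4 * B ^ 2 * (2 * ‖c - c'‖ / ρ)) / ρ ^ 2 +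
        4 * B ^ 2 * (2 * ‖c - c'‖ / ρ ^ 3) := by
        gcongr
        exact hNN.trans (by gcongr)
    _ = _ := by field_simp; ring

lemma abs_principalDensity_sub_sub_le {r r' c : E} (hc : c ≠ 0) :
    |principalDensity (c - r) (c - r') c| ≤
      2 * ‖r‖ * ‖r'‖ / ‖c‖ ^ 2 + (‖r‖ ^ 2 * ‖c - r'‖ + ‖c - r‖ * ‖r'‖ ^ 2) / (2 * ‖c‖ ^ 3) := by
  have hc0 : 0 < ‖c‖ := norm_pos_iff.2 hc
  have gap : ∀ r : E, 0 ≤ ‖c - r‖ * ‖c‖ - ⟪c, c - r⟫ ∧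
      ‖c - r‖ * ‖c‖ - ⟪c, c - r⟫ ≤ ‖r‖ ^ 2 / 2 := by
    intro r
    constructor
    · rw [mul_comm]
      exact sub_nonneg.2 (real_inner_le_norm _ _)
    · have h := norm_sub_sq_real c (c - r)
      rw [sub_sub_cancel] at h
      nlinarith [sq_nonneg (‖c‖ - ‖c - r‖)]
  obtain ⟨x0, x1⟩ := gap r
  obtain ⟨y0, y1⟩ := gap r'
  have hy : |⟪c, c - r⟫| ≤ ‖c - r‖ * ‖c‖ := by
    rw [mul_comm]; exact abs_real_inner_le_norm _ _
  have h1 : ⟪c - r, c - r'⟫ * ‖c‖ ^ 2 - ⟪c, c - r⟫ * ⟪c, c - r'⟫ =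
      ‖c‖ ^ 2 * ⟪r, r'⟫ - ⟪c, r⟫ * ⟪c, r'⟫ := by
    simp only [inner_sub_left, inner_sub_right, real_inner_self_eq_norm_sq]
    rw [real_inner_comm c r]
    ring
  have e : principalDensity (c - r) (c - r') c =
      (⟪c - r, c - r'⟫ * ‖c‖ ^ 2 - ⟪c, c - r⟫ * ⟪c, c - r'⟫) / ‖c‖ ^ 4 +
      ((‖c - r‖ * ‖c‖ - ⟪c, c - r⟫) * (‖c - r'‖ * ‖c‖) +
        ⟪c, c - r⟫ * (‖c - r'‖ * ‖c‖ - ⟪c, c - r'⟫)) / ‖c‖ ^ 4 := by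
    unfold principalDensity
    field_simp
    ring
  rw [e, h1]
  refine (abs_add_le _ _).trans (add_le_add ?_ ?_)
  · rw [abs_div, abs_of_pos (pow_pos hc0 4), div_le_div_iff₀ (by positivity) (by positivity)]
    have h2 : |‖c‖ ^ 2 * ⟪r, r'⟫ - ⟪c, r⟫ * ⟪c, r'⟫| ≤ 2 * ‖r‖ * ‖r'‖ * ‖c‖ ^ 2 := by
      refine (abs_sub _ _).trans ?_
      rw [abs_mul, abs_mul, abs_of_pos (pow_pos hc0 2)]
      calc _ ≤ ‖c‖ ^ 2 * (‖r‖ * ‖r'‖) + (‖c‖ * ‖r‖) * (‖c‖ * ‖r'‖) := by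
            gcongr <;> exact abs_real_inner_le_norm _ _
        _ = _ := by ring
    calc _ ≤ 2 * ‖r‖ * ‖r'‖ * ‖c‖ ^ 2 * ‖c‖ ^ 2 := by gcongr
      _ = _ := by ring
  · rw [abs_div, abs_of_pos (pow_pos hc0 4), div_le_div_iff₀ (by positivity) (by positivity)]
    have h3 : |(‖c - r‖ * ‖c‖ - ⟪c, c - r⟫) * (‖c - r'‖ * ‖c‖) +
        ⟪c, c - r⟫ * (‖c - r'‖ * ‖c‖ - ⟪c, c - r'⟫)| ≤
        ‖r‖ ^ 2 / 2 * (‖c - r'‖ * ‖c‖) + ‖c - r‖ * ‖c‖ * (‖r'‖ ^ 2 / 2) := by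
      refine (abs_add_le _ _).trans ?_
      rw [abs_mul _ (‖c - r'‖ * ‖c‖), abs_mul ⟪c, c - r⟫, abs_of_nonneg x0, abs_of_nonneg y0,
        abs_of_nonneg (by positivity : 0 ≤ ‖c - r'‖ * ‖c‖)]
      gcongr
    calc _ ≤ (‖r‖ ^ 2 / 2 * (‖c - r'‖ * ‖c‖) + ‖c - r‖ * ‖c‖ * (‖r'‖ ^ 2 / 2)) *
          (2 * ‖c‖ ^ 3) := by gcongr
      _ = _ := by ring

/-- The principal density `F(a, b)` of a curve. -/
def contDensity (f : ℝ → E) (a b : ℝ) : ℝ :=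
  principalDensity (deriv f a) (deriv f b) (f b - f a)

lemma contDensity_comm (f : ℝ → E) (a b : ℝ) : contDensity f a b = contDensity f b a := by
  unfold contDensity
  rw [principalDensity_comm, neg_sub]

namespace BiLipschitzLoop

variable {f : ℝ → E} {K L₁ L₂ : ℝ}

lemma contDensity_add_one (hf : BiLipschitzLoop f K L₁ L₂) (a b : ℝ) :
    contDensity f a (b + 1) = contDensity f a b := by
  unfold contDensity
  rw [hf.deriv_add_one, hf.periodic]

lemma contDensity_bounded_aux (hf : BiLipschitzLoop f K L₁ L₂) {a b : ℝ} (h : a < b)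
    (h' : b - a ≤ 1 / 2) :
    |contDensity f a b| ≤ 2 * K ^ 2 / L₁ ^ 2 + K ^ 2 * L₂ / L₁ ^ 3 := by
  set s := b - a with hs
  have hs0 : 0 < s := sub_pos.2 h
  have hK := hf.nonneg
  have hL := hf.pos
  have hL₂ := hf.pos₂
  have hc := hf.lower a b h.le (by linarith)
  rw [min_eq_left (by linarith)] at hc
  have hc0 : 0 < ‖f b - f a‖ := lt_of_lt_of_le (by positivity) hc
  set c := f b - f a with hcdef
  set r := c - s • deriv f a with hr
  set r' := c - s • deriv f b with hr'
  have er : ‖r‖ ≤ K * s ^ 2 := hf.norm_taylor_le a b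
  have er' : ‖r'‖ ≤ K * s ^ 2 := by
    have := hf.norm_taylor_le b a
    rw [← norm_neg] at this
    calc ‖r'‖ = ‖-(f a - f b - (a - b) • deriv f b)‖ := by
          congr 1
          rw [hr', hcdef, hs, sub_smul, sub_smul]
          abel
      _ ≤ _ := this.trans_eq (by rw [hs]; ring)
  have eu : c - r = s • deriv f a := sub_sub_cancel _ _
  have ev : c - r' = s • deriv f b := sub_sub_cancel _ _
  have key := abs_principalDensity_sub_sub_le (r := r) (r' := r') (norm_pos_iff.1 hc0)
  have e := principalDensity_smul hs0.le hs0.le one_ne_zero (deriv f a) (deriv f b) c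
  have hn : ∀ x, ‖s • deriv f x‖ ≤ s * L₂ := fun x => by
    rw [norm_smul, Real.norm_eq_abs, abs_of_pos hs0]
    exact mul_le_mul_of_nonneg_left (hf.norm_deriv_bounds x).2 hs0.le
  rw [eu, ev] at key
  rw [one_smul] at e
  rw [e, abs_mul, abs_of_nonneg (by positivity)] at key
  have h2 : s * s / 1 ^ 2 * |contDensity f a b| ≤
      2 * (K * s ^ 2) * (K * s ^ 2) / (L₁ * s) ^ 2 +
      ((K * s ^ 2) ^ 2 * (s * L₂) + (s * L₂) * (K * s ^ 2) ^ 2) / (2 * (L₁ * s) ^ 3) := by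
    refine key.trans ?_
    gcongr <;> exact hn _
  have h3 : 2 * (K * s ^ 2) * (K * s ^ 2) / (L₁ * s) ^ 2 +
      ((K * s ^ 2) ^ 2 * (s * L₂) + (s * L₂) * (K * s ^ 2) ^ 2) / (2 * (L₁ * s) ^ 3) =
      s * s / 1 ^ 2 * (2 * K ^ 2 / L₁ ^ 2 + K ^ 2 * L₂ / L₁ ^ 3) := by
    field_simp
    ring
  rw [h3] at h2
  exact le_of_mul_le_mul_left h2 (by positivity)

lemma abs_contDensity_le (hf : BiLipschitzLoop f K L₁ L₂) (a b : ℝ) :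
    |contDensity f a b| ≤ 2 * K ^ 2 / L₁ ^ 2 + K ^ 2 * L₂ / L₁ ^ 3 := by
  have hper : Function.Periodic (contDensity f a) 1 := hf.contDensity_add_one a
  rw [← hper.sub_int_mul_eq (round (b - a)), mul_one]
  have h := abs_le.1 (abs_sub_round (b - a))
  rcases lt_trichotomy a (b - round (b - a)) with h1 | h1 | h1
  · exact hf.contDensity_bounded_aux h1 (by linarith)
  · rw [← h1]
    have := hf.pos
    have := hf.pos₂
    have e : contDensity f a a = 0 := by simp [contDensity, principalDensity]
    rw [e, abs_zero]
    positivity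
  · rw [contDensity_comm]
    exact hf.contDensity_bounded_aux h1 (by linarith)

lemma continuous (hf : BiLipschitzLoop f K L₁ L₂) : Continuous f :=
  continuous_iff_continuousAt.2 fun x => (hf.hasDerivAt x).continuousAt

lemma continuous_deriv (hf : BiLipschitzLoop f K L₁ L₂) : Continuous (deriv f) :=
  (LipschitzWith.of_dist_le_mul (K := K.toNNReal) fun x y => by
    rw [Real.coe_toNNReal _ hf.nonneg, dist_eq_norm, Real.dist_eq]
    exact hf.lipschitz x y).continuous

lemma measurable_contDensity (hf : BiLipschitzLoop f K L₁ L₂) :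
    Measurable (fun p : ℝ × ℝ => contDensity f p.1 p.2) := by
  have h0 := hf.continuous
  have h1 := hf.continuous_deriv
  unfold contDensity principalDensity
  refine Measurable.sub (Measurable.div ?_ ?_) (Measurable.div ?_ ?_) <;>
  · refine Continuous.measurable ?_
    fun_prop

end BiLipschitzLoop

end

section

section

variable {G : ℝ → ℝ → ℝ} {C : ℝ}

lemma intervalIntegrable_of_measurable_of_bounded {g : ℝ → ℝ} (hg : Measurable g)
    (hC : ∀ x, |g x| ≤ C) (p q : ℝ) : IntervalIntegrable g volume p q :=
  (intervalIntegrable_const (c := C)).mono_fun' hg.aestronglyMeasurable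
    (Filter.Eventually.of_forall hC)

lemma measurable_intervalIntegral_right (hG : Measurable (fun p : ℝ × ℝ => G p.1 p.2)) {p q : ℝ}
    (hpq : p ≤ q) : Measurable (fun a => ∫ b in p..q, G a b) := by
  simp_rw [intervalIntegral.integral_of_le hpq]
  exact (hG.stronglyMeasurable.integral_prod_right' (ν := volume.restrict (Set.Ioc p q))).measurable

lemma abs_intervalIntegral_le_of_bounded {g : ℝ → ℝ} (hC : ∀ x, |g x| ≤ C) {p q : ℝ}
    (hpq : p ≤ q) : |∫ x in p..q, g x| ≤ C * (q - p) := by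
  have := intervalIntegral.norm_integral_le_of_norm_le_const (a := p) (b := q) (f := g)
    fun x _ => hC x
  rwa [abs_of_nonneg (sub_nonneg.2 hpq)] at this

lemma intervalIntegrable_intervalIntegral_right (hG : Measurable (fun p : ℝ × ℝ => G p.1 p.2))
    (hC : ∀ a b, |G a b| ≤ C) {p q : ℝ} (hpq : p ≤ q) (r s : ℝ) :
    IntervalIntegrable (fun a => ∫ b in p..q, G a b) volume r s :=
  intervalIntegrable_of_measurable_of_bounded (measurable_intervalIntegral_right hG hpq)
    (fun a => abs_intervalIntegral_le_of_bounded (hC a) hpq) r s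

lemma intervalIntegral_swap_of_bounded (hG : Measurable (fun p : ℝ × ℝ => G p.1 p.2))
    (hC : ∀ a b, |G a b| ≤ C) {p q r s : ℝ} (hpq : p ≤ q) (hrs : r ≤ s) :
    ∫ a in p..q, ∫ b in r..s, G a b = ∫ b in r..s, ∫ a in p..q, G a b := by
  simp_rw [intervalIntegral.integral_of_le hpq, intervalIntegral.integral_of_le hrs]
  refine integral_integral_swap ?_
  exact (integrable_const C).mono' hG.aestronglyMeasurable
    (Filter.Eventually.of_forall fun x => hC x.1 x.2)

lemma abs_intervalIntegral_sub_const_le {g : ℝ → ℝ} {p q z M : ℝ} (hpq : p ≤ q)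
    (hg : IntervalIntegrable g volume p q) (h : ∀ x ∈ Set.Icc p q, |g x - z| ≤ M) :
    |(∫ x in p..q, g x) - (q - p) * z| ≤ M * (q - p) := by
  have h1 := intervalIntegral.norm_integral_le_of_norm_le_const (a := p) (b := q)
    (f := fun x => g x - z) (C := M) fun x hx => by
      rw [Set.uIoc_of_le hpq] at hx
      exact h x (Set.Ioc_subset_Icc_self hx)
  rwa [intervalIntegral.integral_sub hg intervalIntegrable_const,
    intervalIntegral.integral_const, smul_eq_mul, abs_of_nonneg (sub_nonneg.2 hpq)] at h1

lemma abs_intervalIntegral_intervalIntegral_sub_le (hG : Measurable (fun p : ℝ × ℝ => G p.1 p.2))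
    (hC : ∀ a b, |G a b| ≤ C) {p q r s z M : ℝ} (hpq : p ≤ q) (hrs : r ≤ s)
    (h : ∀ a ∈ Set.Icc p q, ∀ b ∈ Set.Icc r s, |G a b - z| ≤ M) :
    |(∫ a in p..q, ∫ b in r..s, G a b) - (q - p) * ((s - r) * z)| ≤ M * (s - r) * (q - p) := by
  refine abs_intervalIntegral_sub_const_le hpq
    (intervalIntegrable_intervalIntegral_right hG hC hrs p q) fun a ha => ?_
  exact abs_intervalIntegral_sub_const_le hrs
    (intervalIntegrable_of_measurable_of_bounded (hG.comp measurable_prodMk_left) (hC a) r s)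
    (h a ha)

lemma sum_Icc_integral_adjacent {g : ℝ → ℝ} (hg : ∀ p q, IntervalIntegrable g volume p q)
    (θ : ℤ → ℝ) (m : ℕ) :
    ∑ i ∈ Finset.Icc (1 : ℤ) m, ∫ x in θ i..θ (i + 1), g x = ∫ x in θ 1..θ (1 + m), g x := by
  induction m with
  | zero => simp
  | succ m ih =>
    have e : Finset.Icc (1 : ℤ) (m + 1 : ℕ) = insert ((m : ℤ) + 1) (Finset.Icc (1 : ℤ) m) := by
      ext x
      simp only [Finset.mem_Icc, Finset.mem_insert]
      omega
    rw [e, Finset.sum_insert (by simp), ih, add_comm,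
      add_comm (1 : ℤ) (m : ℤ), intervalIntegral.integral_add_adjacent_intervals (hg _ _) (hg _ _)]
    congr 2
    push_cast
    ring

end

variable {n : ℕ} {f : ℝ → EuclideanSpace ℝ (Fin n)} {K L₁ L₂ : ℝ}

/-- The integral of the principal density over a cell of the grid given by `θ`. -/
def cellIntegral (f : ℝ → EuclideanSpace ℝ (Fin n)) (θ : ℤ → ℝ) (i j : ℤ) : ℝ :=
  ∫ a in θ i..θ (i + 1), ∫ b in θ j..θ (j + 1), contDensity f a b

namespace BiLipschitzLoop

lemma norm_sub_le (hf : BiLipschitzLoop f K L₁ L₂) {a b : ℝ} (h : a ≤ b) (h' : b ≤ a + 1) :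
    ‖f b - f a‖ ≤ L₂ * (b - a) :=
  (hf.upper a b h h').trans (mul_le_mul_of_nonneg_left (min_le_left _ _) hf.pos₂.le)

lemma norm_inv_smul_sub_deriv_le (hf : BiLipschitzLoop f K L₁ L₂) {p q a : ℝ} (hpq : p < q)
    (ha : a ∈ Set.Icc p q) :
    ‖(q - p)⁻¹ • (f q - f p) - deriv f a‖ ≤ 2 * K * (q - p) := by
  have hδ : 0 < q - p := sub_pos.2 hpq
  have h1 := hf.norm_taylor_le p q
  have h2 := hf.lipschitz p a
  have h3 : K * |p - a| ≤ K * (q - p) := by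
    refine mul_le_mul_of_nonneg_left ?_ hf.nonneg
    rw [abs_le]
    constructor <;> linarith [ha.1, ha.2]
  have e : (q - p)⁻¹ • (f q - f p) - deriv f a =
      (q - p)⁻¹ • (f q - f p - (q - p) • deriv f p) + (deriv f p - deriv f a) := by
    rw [smul_sub _ _ ((q - p) • deriv f p), inv_smul_smul₀ hδ.ne']
    abel
  rw [e]
  refine (norm_add_le _ _).trans ?_
  rw [norm_smul, norm_inv, Real.norm_eq_abs, abs_of_pos hδ]
  have h4 : (q - p)⁻¹ * ‖f q - f p - (q - p) • deriv f p‖ ≤ K * (q - p) := by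
    rw [inv_mul_le_iff₀ hδ]
    exact h1.trans_eq (by ring)
  linarith

lemma cellIntegral_comm (hf : BiLipschitzLoop f K L₁ L₂) {θ : ℤ → ℝ} (hθ : Monotone θ)
    (i j : ℤ) : cellIntegral f θ i j = cellIntegral f θ j i := by
  unfold cellIntegral
  rw [intervalIntegral_swap_of_bounded hf.measurable_contDensity hf.abs_contDensity_le
    (hθ (by omega)) (hθ (by omega))]
  simp_rw [contDensity_comm]

lemma cellIntegral_add_period (hf : BiLipschitzLoop f K L₁ L₂) {θ : ℤ → ℝ} {m : ℕ}
    (hθ : ∀ i, θ (i + m) = θ i + 1) (i j : ℤ) :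
    cellIntegral f θ i (j + m) = cellIntegral f θ i j := by
  unfold cellIntegral
  congr 1
  ext a
  rw [add_right_comm, hθ, hθ, ← intervalIntegral.integral_comp_add_right]
  simp_rw [hf.contDensity_add_one]

lemma intervalIntegrable_contDensity (hf : BiLipschitzLoop f K L₁ L₂) (a p q : ℝ) :
    IntervalIntegrable (fun b => contDensity f a b) volume p q :=
  intervalIntegrable_of_measurable_of_bounded
    (hf.measurable_contDensity.comp (measurable_prodMk_left (x := a))) (hf.abs_contDensity_le a) p q

lemma intervalIntegrable_integral_contDensity (hf : BiLipschitzLoop f K L₁ L₂) {p q : ℝ}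
    (hpq : p ≤ q) (r s : ℝ) :
    IntervalIntegrable (fun a => ∫ b in p..q, contDensity f a b) volume r s :=
  intervalIntegrable_intervalIntegral_right hf.measurable_contDensity hf.abs_contDensity_le hpq r s

lemma sum_cellIntegral (hf : BiLipschitzLoop f K L₁ L₂) {θ : ℤ → ℝ} {m : ℕ}
    (hmono : Monotone θ) (hθ : ∀ i, θ (i + m) = θ i + 1) :
    ∑ i ∈ Finset.Icc (1 : ℤ) m, ∑ j ∈ Finset.Icc (1 : ℤ) m, cellIntegral f θ i j =
      ∫ a in (0 : ℝ)..1, ∫ b in (0 : ℝ)..1, contDensity f a b := by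
  have inner : ∀ a, ∫ b in θ 1..θ 1 + 1, contDensity f a b =
      ∫ b in (0 : ℝ)..1, contDensity f a b := fun a => by
    have hper : Function.Periodic (contDensity f a) 1 := hf.contDensity_add_one a
    have := hper.intervalIntegral_add_eq (θ 1) 0
    rwa [zero_add] at this
  have h1 : ∀ i : ℤ, ∑ j ∈ Finset.Icc (1 : ℤ) m, cellIntegral f θ i j =
      ∫ a in θ i..θ (i + 1), ∫ b in (0 : ℝ)..1, contDensity f a b := fun i => by
    unfold cellIntegral
    refine (intervalIntegral.integral_finsetSum
      (f := fun (j : ℤ) a => ∫ b in θ j..θ (j + 1), contDensity f a b) fun j _ =>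
      hf.intervalIntegrable_integral_contDensity (hmono (by omega : j ≤ j + 1)) _ _).symm.trans ?_
    refine intervalIntegral.integral_congr fun a _ => ?_
    rw [sum_Icc_integral_adjacent (hf.intervalIntegrable_contDensity a), hθ, inner]
  simp_rw [h1]
  rw [sum_Icc_integral_adjacent (hf.intervalIntegrable_integral_contDensity zero_le_one),
    hθ]
  have hper : Function.Periodic (fun a => ∫ b in (0 : ℝ)..1, contDensity f a b) 1 := fun a => by
    refine intervalIntegral.integral_congr fun b _ => ?_
    rw [contDensity_comm f _ b, hf.contDensity_add_one, contDensity_comm]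
  have := hper.intervalIntegral_add_eq (θ 1) 0
  rwa [zero_add] at this

end BiLipschitzLoop

theorem disc_sub_cellIntegral_bounds (hf : BiLipschitzLoop f K L₁ L₂) :
    ∃ C, 0 ≤ C ∧ ∀ (θ : ℤ → ℝ) (m : ℕ) (h : ℝ), EquilateralParam f θ m h →
      L₂ < L₁ * (m - 1) → (∀ i j, |cellIntegral f θ i j| ≤ C / m ^ 2) ∧
      ∀ (i : ℤ) (k : ℕ), 1 ≤ k → 2 * k ≤ m →
      |discPrincipal f θ i (i + k) - cellIntegral f θ i (i + k)| ≤ C / m ^ 2 ∧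
      |discPrincipal f θ i (i + k) - cellIntegral f θ i (i + k)| ≤ C / k ^ 3 := by
  obtain ⟨C₀, hC₀, hdisc⟩ := disc_density_bounds hf
  have hL₁ := hf.pos
  have hL₂ := hf.pos₂
  have hK := hf.nonneg
  have hG := hf.measurable_contDensity
  have hC := hf.abs_contDensity_le
  set CF := 2 * K ^ 2 / L₁ ^ 2 + K ^ 2 * L₂ / L₁ ^ 3 with hCF
  have hCF0 : 0 ≤ CF := by positivity
  set D := L₂ / L₁ with hD
  have hD0 : 0 < D := by positivity
  set κ := L₁ ^ 2 / (2 * L₂) with hκ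
  have hκ0 : 0 < κ := by positivity
  set A := 16 * L₂ * K * D / κ ^ 2 + 32 * L₂ ^ 3 * D / κ ^ 3 with hA
  have hA0 : 0 ≤ A := by positivity
  refine ⟨C₀ + CF * D ^ 2 + A * D ^ 2, by positivity, ?_⟩
  intro θ m h hθ hm
  have h2 := EquilateralParam.two_le hf hm
  have hh := hθ.pos hf hm
  have hm0 : (0 : ℝ) < m := by exact_mod_cast (by omega : 0 < m)
  have hmh := hθ.edge_bounds hf hm
  have hmono := hθ.strictMono.monotone
  have hδ0 : ∀ i, 0 < θ (i + 1) - θ i := fun i => (hθ.step_bounds hf hm i).1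
  have hδ : ∀ i, θ (i + 1) - θ i ≤ D / m := fun i => by
    have := (hθ.step_bounds hf hm i).2.2
    rw [hD, div_div, le_div_iff₀ (by positivity)]
    nlinarith
  have hcell : ∀ i j, |cellIntegral f θ i j| ≤ CF * D ^ 2 / m ^ 2 := fun i j => by
    have := abs_intervalIntegral_intervalIntegral_sub_le hG hC (z := 0) (M := CF)
      (hmono (by omega : i ≤ i + 1)) (hmono (by omega : j ≤ j + 1))
      (fun a _ b _ => by rw [sub_zero]; exact hC a b)
    rw [mul_zero, mul_zero, sub_zero] at this
    refine this.trans ?_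
    calc _ ≤ CF * (D / m) * (D / m) := by
          gcongr
          · exact (hδ0 i).le
          · exact hδ j
          · exact hδ i
      _ = _ := by ring
  have near : ∀ (i : ℤ) (k : ℕ), 1 ≤ k → 2 * k ≤ m →
      |discPrincipal f θ i (i + k) - cellIntegral f θ i (i + k)| ≤ 
        (C₀ + CF * D ^ 2) / m ^ 2 := fun i k hk hkm => by
    refine (abs_sub _ _).trans ?_
    rw [add_div]
    exact add_le_add (hdisc θ m h hθ hm i k hk hkm).1 (hcell _ _)
  have hAD : 0 ≤ A * D ^ 2 := by positivity
  have hCD : 0 ≤ CF * D ^ 2 := by positivity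
  refine ⟨fun i j => (hcell i j).trans ?_, fun i k hk hkm =>
    ⟨(near i k hk hkm).trans ?_, ?_⟩⟩
  · exact div_le_div_of_nonneg_right (by linarith) (by positivity)
  · exact div_le_div_of_nonneg_right (by linarith) (by positivity)
  have hk0 : (0 : ℝ) < k := by exact_mod_cast (by omega : 0 < k)
  have hkm' : (k : ℝ) ≤ m := by exact_mod_cast (by omega : k ≤ m)
  rcases hk.eq_or_lt with rfl | hk2
  · refine (near i 1 le_rfl hkm).trans ?_
    have : (1 : ℝ) ≤ m := by simpa using hkm'
    rw [Nat.cast_one, one_pow, div_one]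
    refine (div_le_self (by positivity) (one_le_pow₀ this)).trans ?_
    linarith
  set j : ℤ := i + k with hj
  set ρ := κ * (k / m) with hρ
  have hρ0 : 0 < ρ := by positivity
  have hord : ∀ a ∈ Set.Icc (θ i) (θ (i + 1)), ∀ b ∈ Set.Icc (θ j) (θ (j + 1)),
      ρ ≤ ‖f b - f a‖ := by
    intro a ha b hb
    have h1 : a ≤ b := (ha.2.trans (hmono (by omega))).trans hb.1
    have h3 : θ (j + 1) ≤ θ (i + m) := hmono (by omega)
    rw [hθ.periodic] at h3
    have h4 : b ≤ a + 1 := by linarith [hb.2, ha.1]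
    refine le_trans ?_ (hf.lower a b h1 h4)
    have s1 := hθ.le_mul_sub hf (by omega) (i + 1) (k - 1)
    have s2 := hθ.le_mul_sub hf (by omega) (j + 1) (m - (k + 1))
    have e1 : i + 1 + ((k - 1 : ℕ) : ℤ) = j := by omega
    have e2 : j + 1 + ((m - (k + 1) : ℕ) : ℤ) = i + m := by omega
    rw [e1] at s1
    rw [e2, hθ.periodic] at s2
    have c1 : (k : ℝ) / 2 ≤ ((k - 1 : ℕ) : ℝ) := by
      have : (2 : ℝ) ≤ k := by exact_mod_cast hk2
      rw [Nat.cast_sub hk, Nat.cast_one]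
      linarith
    have c2 : (k : ℝ) / 2 ≤ ((m - (k + 1) : ℕ) : ℝ) :=
      c1.trans (by exact_mod_cast (by omega))
    have c3 : (k : ℝ) / 2 * (L₁ / m) ≤ k / 2 * h := by
      gcongr
      rw [div_le_iff₀ hm0]
      linarith [hmh.1]
    have s1' := mul_le_mul_of_nonneg_right c1 hh.le
    have s2' := mul_le_mul_of_nonneg_right c2 hh.le
    have e : ρ = L₁ * ((k / 2 * (L₁ / m)) / L₂) := by
      rw [hρ, hκ]
      field_simp
    rw [e]
    have t1 := mul_le_mul_of_nonneg_left (sub_le_sub hb.1 ha.2) hL₂.le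
    have t2 := mul_le_mul_of_nonneg_left (sub_le_sub (add_le_add_left ha.1 1) hb.2) hL₂.le
    refine mul_le_mul_of_nonneg_left (le_min ?_ ?_) hL₁.le <;> rw [div_le_iff₀ hL₂] <;> linarith
  have hu : ∀ i, ‖(θ (i + 1) - θ i)⁻¹ • edge f θ i‖ ≤ L₂ := fun i => by
    rw [norm_smul, norm_inv, Real.norm_eq_abs, abs_of_pos (hδ0 i), inv_mul_le_iff₀ (hδ0 i),
      mul_comm]
    exact hf.norm_sub_le (hmono (by omega)) (hθ.le_add_one (by omega) i)
  have hcomp : ∀ a ∈ Set.Icc (θ i) (θ (i + 1)), ∀ b ∈ Set.Icc (θ j) (θ (j + 1)),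
      |contDensity f a b - principalDensity ((θ (i + 1) - θ i)⁻¹ • edge f θ i)
        ((θ (j + 1) - θ j)⁻¹ • edge f θ j) (chord f θ i j)| ≤ A * (m ^ 2 / k ^ 3) := by
    intro a ha b hb
    have key := abs_principalDensity_sub_le hρ0 (hf.norm_deriv_bounds a).2
      (hf.norm_deriv_bounds b).2 (hu i) (hu j) (hord a ha b hb)
      (hord (θ i) (Set.left_mem_Icc.2 (hmono (by omega))) (θ j)
        (Set.left_mem_Icc.2 (hmono (by omega))))
    have d1 : ‖deriv f a - (θ (i + 1) - θ i)⁻¹ • (f (θ (i + 1)) - f (θ i))‖ ≤ 2 * K * (D / m) := by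
      rw [norm_sub_rev]
      exact (hf.norm_inv_smul_sub_deriv_le (sub_pos.1 (hδ0 i)) ha).trans (by gcongr; exact hδ i)
    have d2 : ‖deriv f b - (θ (j + 1) - θ j)⁻¹ • (f (θ (j + 1)) - f (θ j))‖ ≤ 2 * K * (D / m) := by
      rw [norm_sub_rev]
      exact (hf.norm_inv_smul_sub_deriv_le (sub_pos.1 (hδ0 j)) hb).trans (by gcongr; exact hδ j)
    have d3 : ‖f b - f a - (f (θ j) - f (θ i))‖ ≤ 2 * L₂ * (D / m) := by
      have n1 := hf.norm_sub_le ha.1 (ha.2.trans (hθ.le_add_one (by omega) i))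
      have n2 := hf.norm_sub_le hb.1 (hb.2.trans (hθ.le_add_one (by omega) j))
      have n3 : L₂ * (a - θ i) ≤ L₂ * (D / m) :=
        mul_le_mul_of_nonneg_left (by linarith [ha.2, hδ i]) hL₂.le
      have n4 : L₂ * (b - θ j) ≤ L₂ * (D / m) :=
        mul_le_mul_of_nonneg_left (by linarith [hb.2, hδ j]) hL₂.le
      calc _ = ‖(f b - f (θ j)) - (f a - f (θ i))‖ := by congr 1; abel
        _ ≤ _ := norm_sub_le _ _
        _ ≤ _ := by linarith
    refine key.trans ?_
    calc _ ≤ 4 * L₂ * (2 * K * (D / m) + 2 * K * (D / m)) / ρ ^ 2 +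
          16 * L₂ ^ 2 * (2 * L₂ * (D / m)) / ρ ^ 3 := by
          gcongr
          · exact d1
          · exact d2
      _ = 16 * L₂ * K * D / κ ^ 2 * (m * k / k ^ 3) + 32 * L₂ ^ 3 * D / κ ^ 3 * (m ^ 2 / k ^ 3) := by
          rw [hρ]
          field_simp
          ring
      _ ≤ 16 * L₂ * K * D / κ ^ 2 * (m ^ 2 / k ^ 3) +
          32 * L₂ ^ 3 * D / κ ^ 3 * (m ^ 2 / k ^ 3) := by
          gcongr
          rw [pow_two]
          gcongr
      _ = _ := by rw [hA]; ring
  have hsm := principalDensity_smul (hδ0 i).le (hδ0 j).le one_ne_zero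
    ((θ (i + 1) - θ i)⁻¹ • edge f θ i) ((θ (j + 1) - θ j)⁻¹ • edge f θ j) (chord f θ i j)
  rw [smul_inv_smul₀ (hδ0 i).ne', smul_inv_smul₀ (hδ0 j).ne', one_smul] at hsm
  have fin := abs_intervalIntegral_intervalIntegral_sub_le hG hC (hmono (by omega : i ≤ i + 1))
    (hmono (by omega : j ≤ j + 1)) hcomp
  rw [abs_sub_comm, discPrincipal, hsm, one_pow, div_one, mul_assoc]
  refine fin.trans ?_
  calc _ ≤ A * (m ^ 2 / k ^ 3) * (D / m) * (D / m) := by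
        gcongr
        · exact (hδ0 i).le
        · exact hδ j
        · exact hδ i
    _ = A * D ^ 2 / k ^ 3 := by field_simp
    _ ≤ _ := by gcongr; linarith

end

section

variable {n : ℕ} {f : ℝ → EuclideanSpace ℝ (Fin n)} {K L₁ L₂ : ℝ} {θ : ℕ → ℤ → ℝ} {h : ℕ → ℝ}

lemma exists_forall_lt_mul_sub_one {L₁ : ℝ} (L₂ : ℝ) (h : 0 < L₁) :
    ∃ m₀ : ℕ, 1 ≤ m₀ ∧ ∀ m, m₀ ≤ m → L₂ < L₁ * ((m : ℝ) - 1) := by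
  obtain ⟨N, hN⟩ := exists_nat_gt (L₂ / L₁ + 1)
  refine ⟨N + 1, by omega, fun m hm => ?_⟩
  have h1 : (N : ℝ) ≤ m := by exact_mod_cast (by omega : N ≤ m)
  rw [mul_comm, ← div_lt_iff₀ h]
  linarith

theorem tendsto_discSum_discMobius_sub_discPrincipal (hf : BiLipschitzLoop f K L₁ L₂)
    (hθ : ∀ m, 1 ≤ m → EquilateralParam f (θ m) m (h m)) :
    Filter.Tendsto (fun m : ℕ => discSum m fun i j =>
      discMobius f (θ m) i j - discPrincipal f (θ m) i j) Filter.atTop (nhds 0) := by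
  obtain ⟨m₀, h1, hm₀⟩ := exists_forall_lt_mul_sub_one L₂ hf.pos
  obtain ⟨C, hC, hb⟩ := disc_density_bounds hf
  refine tendsto_discSum_zero_of_decay (m₀ := m₀) hC
    (T := fun m i j => discMobius f (θ m) i j - discPrincipal f (θ m) i j)
    (fun m _ i j => ?_) (fun m hm i j => ?_)
    (fun m hm i k hk hkm => (hb _ m _ (hθ m (h1.trans hm)) (hm₀ m hm) i k hk hkm).2.1)
    (fun m hm i k hk hkm => (hb _ m _ (hθ m (h1.trans hm)) (hm₀ m hm) i k hk hkm).2.2)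
  · rw [discMobius_comm, discPrincipal_comm]
  · have hp := (hθ m (h1.trans hm)).periodic
    rw [discMobius_add_period hf.periodic hp, discPrincipal_add_period hf.periodic hp]

theorem tendsto_discSum_discPrincipal (hf : BiLipschitzLoop f K L₁ L₂)
    (hθ : ∀ m, 1 ≤ m → EquilateralParam f (θ m) m (h m)) :
    Filter.Tendsto (fun m : ℕ => discSum m (discPrincipal f (θ m))) Filter.atTop
      (nhds (∫ a in (0 : ℝ)..1, ∫ b in (0 : ℝ)..1, contDensity f a b)) := by
  obtain ⟨m₀, h1, hm₀⟩ := exists_forall_lt_mul_sub_one L₂ hf.pos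
  obtain ⟨C, hC, hb⟩ := disc_sub_cellIntegral_bounds hf
  have l1 := tendsto_discSum_zero_of_decay (m₀ := m₀) hC
    (T := fun m i j => discPrincipal f (θ m) i j - cellIntegral f (θ m) i j)
    (fun m hm i j => by
      rw [discPrincipal_comm, hf.cellIntegral_comm (hθ m (h1.trans hm)).strictMono.monotone])
    (fun m hm i j => by
      have hp := (hθ m (h1.trans hm)).periodic
      rw [discPrincipal_add_period hf.periodic hp, hf.cellIntegral_add_period hp])
    (fun m hm i k hk hkm => ((hb _ m _ (hθ m (h1.trans hm)) (hm₀ m hm)).2 i k hk hkm).1)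
    (fun m hm i k hk hkm => ((hb _ m _ (hθ m (h1.trans hm)) (hm₀ m hm)).2 i k hk hkm).2)
  have l2 : Filter.Tendsto (fun m : ℕ => ∑ i ∈ Finset.Icc (1 : ℤ) m, cellIntegral f (θ m) i i)
      Filter.atTop (nhds 0) := by
    refine squeeze_zero_norm' ?_ (tendsto_const_div_atTop_nhds_zero_nat C)
    filter_upwards [Filter.eventually_ge_atTop m₀] with m hm
    have hm0 : (0 : ℝ) < m := by exact_mod_cast (by omega : 0 < m)
    refine (norm_sum_le _ _).trans ((Finset.sum_le_sum fun i _ =>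
      (hb _ m _ (hθ m (h1.trans hm)) (hm₀ m hm)).1 i i).trans ?_)
    rw [Finset.sum_const, Int.card_Icc, nsmul_eq_mul]
    have e : (((m : ℤ) + 1 - 1).toNat : ℝ) = m := by simp
    rw [e]
    apply le_of_eq
    field_simp
  have l3 := (l1.add (tendsto_const_nhds
    (x := ∫ a in (0 : ℝ)..1, ∫ b in (0 : ℝ)..1, contDensity f a b))).sub l2
  rw [zero_add, sub_zero] at l3
  refine l3.congr' ?_
  filter_upwards [Filter.eventually_ge_atTop m₀] with m hm
  have hp := hθ m (h1.trans hm)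
  rw [← hf.sum_cellIntegral hp.strictMono.monotone hp.periodic]
  unfold discSum
  rw [← Finset.sum_add_distrib, ← Finset.sum_sub_distrib]
  refine Finset.sum_congr rfl fun i hi => ?_
  rw [← Finset.sum_add_distrib, sub_eq_iff_eq_add]
  have e : cellIntegral f (θ m) i i = ∑ j ∈ Finset.Icc (1 : ℤ) m,
      if i = j then cellIntegral f (θ m) i j else 0 := by
    rw [Finset.sum_ite_eq, if_pos hi]
  rw [e, ← Finset.sum_add_distrib]
  refine Finset.sum_congr rfl fun j _ => ?_
  split_ifs <;> ring

end

section

variable {n : ℕ} {f : ℝ → EuclideanSpace ℝ (Fin n)} {K L₁ L₂ : ℝ}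

/-- The signed arclength of `f` from `a` to `b`. -/
def arclen (f : ℝ → EuclideanSpace ℝ (Fin n)) (a b : ℝ) : ℝ := ∫ t in a..b, ‖deriv f t‖

/-- The Möbius energy density of `f`. -/
def mobiusDensity (f : ℝ → EuclideanSpace ℝ (Fin n)) (a b : ℝ) : ℝ :=
  (1 / ‖f a - f b‖ ^ 2 - 1 / intrDist f a b ^ 2) * (‖deriv f a‖ * ‖deriv f b‖)

lemma arclen_symm (a b : ℝ) : arclen f b a = -arclen f a b := intervalIntegral.integral_symm _ _

namespace BiLipschitzLoop

lemma hasDerivAt_arclen (hf : BiLipschitzLoop f K L₁ L₂) (a b : ℝ) :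
    HasDerivAt (arclen f a) ‖deriv f b‖ b :=
  (hf.continuous_deriv.norm.integral_hasStrictDerivAt a b).hasDerivAt

lemma intervalIntegrable_norm_deriv (hf : BiLipschitzLoop f K L₁ L₂) (a b : ℝ) :
    IntervalIntegrable (fun t => ‖deriv f t‖) volume a b :=
  hf.continuous_deriv.norm.intervalIntegrable a b

lemma arclen_add (hf : BiLipschitzLoop f K L₁ L₂) (a b c : ℝ) :
    arclen f a b + arclen f b c = arclen f a c :=
  intervalIntegral.integral_add_adjacent_intervals (hf.intervalIntegrable_norm_deriv a b)
    (hf.intervalIntegrable_norm_deriv b c)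

lemma arclen_add_one (hf : BiLipschitzLoop f K L₁ L₂) (a : ℝ) :
    arclen f a (a + 1) = arclen f 0 1 := by
  have hper : Function.Periodic (fun t => ‖deriv f t‖) 1 := fun t => by
    simp only [hf.deriv_add_one]
  have h := hper.intervalIntegral_add_eq a 0
  rwa [zero_add] at h

lemma arclen_bounds (hf : BiLipschitzLoop f K L₁ L₂) {a b : ℝ} (h : a ≤ b) :
    L₁ * (b - a) ≤ arclen f a b ∧ arclen f a b ≤ L₂ * (b - a) := by
  have h1 := intervalIntegral.integral_mono_on h (intervalIntegrable_const (c := L₁))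
    (hf.intervalIntegrable_norm_deriv a b) fun x _ => (hf.norm_deriv_bounds x).1
  have h2 := intervalIntegral.integral_mono_on h (hf.intervalIntegrable_norm_deriv a b)
    (intervalIntegrable_const (c := L₂)) fun x _ => (hf.norm_deriv_bounds x).2
  rw [intervalIntegral.integral_const, smul_eq_mul, mul_comm] at h1 h2
  exact ⟨h1, h2⟩

lemma abs_arclen_bounds (hf : BiLipschitzLoop f K L₁ L₂) (a b : ℝ) :
    L₁ * |b - a| ≤ |arclen f a b| ∧ |arclen f a b| ≤ L₂ * |b - a| := by
  wlog h : a ≤ b generalizing a b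
  · have := this b a (le_of_not_ge h)
    rwa [arclen_symm, abs_neg, abs_sub_comm] at this
  have h0 := hf.arclen_bounds h
  rw [abs_of_nonneg (sub_nonneg.2 h), abs_of_nonneg]
  · exact h0
  · exact (mul_nonneg hf.pos.le (sub_nonneg.2 h)).trans h0.1

lemma norm_sub_le_abs_arclen (hf : BiLipschitzLoop f K L₁ L₂) (a b : ℝ) :
    ‖f b - f a‖ ≤ |arclen f a b| := by
  rw [← intervalIntegral.integral_eq_sub_of_hasDerivAt (fun x _ => hf.hasDerivAt x)
    (hf.continuous_deriv.intervalIntegrable a b)]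
  exact intervalIntegral.norm_integral_le_abs_integral_norm

lemma abs_arclen_sub_inner_le (hf : BiLipschitzLoop f K L₁ L₂) (a b : ℝ) :
    |‖deriv f a‖ * arclen f a b - ⟪deriv f a, f b - f a⟫| ≤ K ^ 2 * |b - a| ^ 3 := by
  have h := (convex_uIcc a b).norm_image_sub_le_of_norm_hasDerivWithin_le
    (f := fun x => ‖deriv f a‖ * arclen f a x - ⟪deriv f a, f x - f a⟫)
    (f' := fun x => ‖deriv f a‖ * ‖deriv f x‖ - ⟪deriv f a, deriv f x⟫)
    (C := K ^ 2 * |b - a| ^ 2) (x := a) (y := b) (fun x _ => by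
      have h1 := (hasDerivAt_const x (deriv f a)).inner ℝ ((hf.hasDerivAt x).sub_const (f a))
      simp only [inner_zero_left, add_zero] at h1
      exact (((hf.hasDerivAt_arclen a x).const_mul _).sub h1).hasDerivWithinAt) (fun x hx => by
      have h1 := hf.lipschitz x a
      have h2 : K * |x - a| ≤ K * |b - a| :=
        mul_le_mul_of_nonneg_left (Set.abs_sub_left_of_mem_uIcc hx) hf.nonneg
      have h3 := pow_le_pow_left₀ (norm_nonneg _) (h1.trans h2) 2
      rw [norm_sub_sq_real, real_inner_comm] at h3
      have h4 := real_inner_le_norm (deriv f a) (deriv f x)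
      rw [Real.norm_eq_abs, abs_of_nonneg (sub_nonneg.2 h4)]
      nlinarith [sq_nonneg (‖deriv f x‖ - ‖deriv f a‖)]) Set.left_mem_uIcc Set.right_mem_uIcc
  have e : arclen f a a = 0 := intervalIntegral.integral_same
  simp only [e, sub_self, inner_zero_right, mul_zero, sub_zero, Real.norm_eq_abs] at h
  exact h.trans_eq (by ring)

lemma abs_arclen_sub_norm_le (hf : BiLipschitzLoop f K L₁ L₂) (a b : ℝ) :
    |arclen f a b| - ‖f b - f a‖ ≤ K ^ 2 * |b - a| ^ 3 / L₁ := by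
  have hg := (hf.norm_deriv_bounds a).1
  have hg0 := hf.pos.trans_le hg
  have h1 := hf.abs_arclen_sub_inner_le a b
  have h2 := abs_real_inner_le_norm (deriv f a) (f b - f a)
  have h3 := abs_sub_abs_le_abs_sub (‖deriv f a‖ * arclen f a b) ⟪deriv f a, f b - f a⟫
  rw [abs_mul, abs_norm] at h3
  have h4 := sub_nonneg.2 (hf.norm_sub_le_abs_arclen a b)
  rw [le_div_iff₀ hf.pos]
  nlinarith [mul_le_mul_of_nonneg_left hg h4]

lemma inv_sq_sub_inv_sq_bounds (hf : BiLipschitzLoop f K L₁ L₂) {a b κ : ℝ} (hκ : 0 < κ)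
    (hab : b ≠ a) (h : κ * |b - a| ≤ ‖f b - f a‖) :
    |1 / ‖f b - f a‖ ^ 2 - 1 / arclen f a b ^ 2| ≤ 2 * K ^ 2 / (L₁ ^ 2 * κ ^ 2) := by
  have hL := hf.pos
  have hs : 0 < |b - a| := abs_pos.2 (sub_ne_zero.2 hab)
  have h1 := hf.norm_sub_le_abs_arclen a b
  have h2 := hf.abs_arclen_sub_norm_le a b
  have h3 := (hf.abs_arclen_bounds a b).1
  rw [← sq_abs (arclen f a b)]
  set S := |arclen f a b|
  set c := ‖f b - f a‖
  have hc : 0 < c := (mul_pos hκ hs).trans_le h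
  have hS : 0 < S := hc.trans_le h1
  have e : 1 / c ^ 2 - 1 / S ^ 2 = (S - c) * (S + c) / (c ^ 2 * S ^ 2) := by
    field_simp
    ring
  have h0 : 0 ≤ S - c := sub_nonneg.2 h1
  rw [e, abs_of_nonneg (by positivity)]
  calc (S - c) * (S + c) / (c ^ 2 * S ^ 2)
      ≤ (K ^ 2 * |b - a| ^ 3 / L₁) * (S + S) / (c ^ 2 * S ^ 2) := by gcongr
    _ = 2 * (K ^ 2 * |b - a| ^ 3 / L₁) / (c ^ 2 * S) := by field_simp; ring
    _ ≤ 2 * (K ^ 2 * |b - a| ^ 3 / L₁) / ((κ * |b - a|) ^ 2 * (L₁ * |b - a|)) := by gcongr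
    _ = _ := by field_simp

lemma le_norm_sub_of_abs_arclen_le (hf : BiLipschitzLoop f K L₁ L₂) {a b : ℝ}
    (h : |b - a| ≤ 1) (hS : |arclen f a b| ≤ arclen f 0 1 / 2) :
    L₁ ^ 2 / (2 * L₂) * |b - a| ≤ ‖f b - f a‖ := by
  wlog hab : a ≤ b generalizing a b
  · have := this (a := b) (b := a) (by rwa [abs_sub_comm]) (by rwa [arclen_symm, abs_neg])
      (le_of_not_ge hab)
    rwa [abs_sub_comm, norm_sub_rev] at this
  have hL := hf.pos
  have hL₂ := hf.pos₂
  rw [abs_of_nonneg (sub_nonneg.2 hab)] at h ⊢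
  refine le_trans ?_ (hf.lower a b hab (by linarith))
  have h1 := (hf.arclen_bounds (show b ≤ a + 1 by linarith)).2
  have h2 := hf.arclen_add a b (a + 1)
  rw [hf.arclen_add_one] at h2
  have h3 := (hf.arclen_bounds (zero_le_one)).1
  have h4 := le_abs_self (arclen f a b)
  have e : L₁ ^ 2 / (2 * L₂) * (b - a) = L₁ * (L₁ * (b - a) / (2 * L₂)) := by ring
  have hs : 0 ≤ b - a := sub_nonneg.2 hab
  rw [e]
  refine mul_le_mul_of_nonneg_left (le_min ?_ ?_) hL.le <;> rw [div_le_iff₀ (by positivity)]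
  · nlinarith [hf.le]
  · nlinarith [hf.le]

lemma exists_arclen_eq_half (hf : BiLipschitzLoop f K L₁ L₂) (a : ℝ) :
    ∃ p, p < a ∧ a < p + 1 ∧ arclen f a p = -(arclen f 0 1 / 2) ∧
      arclen f a (p + 1) = arclen f 0 1 / 2 := by
  have h0 := (hf.arclen_bounds (zero_le_one)).1
  have hL := hf.pos
  have hT : 0 < arclen f 0 1 := by linarith
  have hc : Continuous (arclen f a) :=
    continuous_iff_continuousAt.2 fun x => (hf.hasDerivAt_arclen a x).continuousAt
  have e0 : arclen f a a = 0 := intervalIntegral.integral_same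
  have e1 := hf.arclen_add_one a
  obtain ⟨q, hq, hqS⟩ := intermediate_value_Icc (show a ≤ a + 1 by linarith) hc.continuousOn
    (show arclen f 0 1 / 2 ∈ Set.Icc (arclen f a a) (arclen f a (a + 1)) by
      rw [e0, e1]; constructor <;> linarith)
  refine ⟨q - 1, ?_, ?_, ?_, ?_⟩
  · refine lt_of_le_of_ne (by linarith [hq.2]) fun h => ?_
    have : q = a + 1 := by linarith
    rw [this] at hqS
    linarith
  · refine lt_of_le_of_ne (by linarith [hq.1]) fun h => ?_
    have : q = a := by linarith
    rw [this] at hqS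
    linarith
  · have h1 := hf.arclen_add a (q - 1) (q - 1 + 1)
    rw [hf.arclen_add_one, sub_add_cancel] at h1
    linarith
  · rwa [sub_add_cancel]

lemma abs_arclen_le_half (hf : BiLipschitzLoop f K L₁ L₂) {a b p : ℝ}
    (h1 : arclen f a p = -(arclen f 0 1 / 2)) (h2 : arclen f a (p + 1) = arclen f 0 1 / 2)
    (hb : b ∈ Set.Icc p (p + 1)) : |arclen f a b| ≤ arclen f 0 1 / 2 := by
  have i1 := (hf.arclen_bounds hb.1).1
  have i2 := (hf.arclen_bounds hb.2).1
  have i3 := hf.arclen_add a p b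
  have i4 := hf.arclen_add a b (p + 1)
  have i5 : 0 ≤ L₁ * (b - p) := mul_nonneg hf.pos.le (sub_nonneg.2 hb.1)
  have i6 : 0 ≤ L₁ * (p + 1 - b) := mul_nonneg hf.pos.le (sub_nonneg.2 hb.2)
  rw [abs_le]
  constructor <;> linarith

lemma hasDerivAt_inner_div_sub (hf : BiLipschitzLoop f K L₁ L₂) {a b : ℝ}
    (hc : f b - f a ≠ 0) (hS : arclen f a b ≠ 0) :
    HasDerivAt (fun b => ⟪deriv f a, f b - f a⟫ / ‖f b - f a‖ ^ 2 - ‖deriv f a‖ / arclen f a b)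
      (contDensity f a b - (1 / ‖f b - f a‖ ^ 2 - 1 / arclen f a b ^ 2) *
        (‖deriv f a‖ * ‖deriv f b‖)) b := by
  have hd := (hf.hasDerivAt b).sub_const (f a)
  have h1 := (hasDerivAt_const b (deriv f a)).inner ℝ hd
  have hc0 : ‖f b - f a‖ ≠ 0 := norm_ne_zero_iff.2 hc
  have h2 := hd.norm_sq
  have h3 := (h1.div h2 (pow_ne_zero 2 hc0)).sub
    ((hasDerivAt_const b ‖deriv f a‖).div (hf.hasDerivAt_arclen a b) hS)
  refine h3.congr_deriv ?_
  unfold contDensity principalDensity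
  rw [inner_zero_left, real_inner_comm (f b - f a) (deriv f a)]
  field_simp
  ring

lemma integral_contDensity_sub (hf : BiLipschitzLoop f K L₁ L₂) {a p : ℝ} (hp : p < a)
    (hp' : a < p + 1) (h1 : arclen f a p = -(arclen f 0 1 / 2))
    (h2 : arclen f a (p + 1) = arclen f 0 1 / 2) :
    (∫ b in p..p + 1, (1 / ‖f b - f a‖ ^ 2 - 1 / arclen f a b ^ 2) *
      (‖deriv f a‖ * ‖deriv f b‖)) =
    (∫ b in p..p + 1, contDensity f a b) + 4 * ‖deriv f a‖ / arclen f 0 1 := by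
  have hL := hf.pos
  have hL₂ := hf.pos₂
  have hT : 0 < arclen f 0 1 := by linarith [(hf.arclen_bounds (zero_le_one)).1]
  set κ := L₁ ^ 2 / (2 * L₂) with hκdef
  have hκ : 0 < κ := by positivity
  have hκb : ∀ b ∈ Set.Icc p (p + 1), κ * |b - a| ≤ ‖f b - f a‖ := fun b hb =>
    hf.le_norm_sub_of_abs_arclen_le
      (abs_le.2 ⟨by linarith [hb.1], by linarith [hb.2]⟩) (hf.abs_arclen_le_half h1 h2 hb)
  have hne : ∀ b ∈ Set.Icc p (p + 1), b ≠ a → f b - f a ≠ 0 ∧ arclen f a b ≠ 0 := by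
    intro b hb hba
    have hs : 0 < |b - a| := abs_pos.2 (sub_ne_zero.2 hba)
    have i1 := (mul_pos hκ hs).trans_le (hκb b hb)
    exact ⟨norm_pos_iff.1 i1, abs_pos.1 (i1.trans_le (hf.norm_sub_le_abs_arclen a b))⟩
  have hSc : Continuous (arclen f a) :=
    continuous_iff_continuousAt.2 fun x => (hf.hasDerivAt_arclen a x).continuousAt
  set CQ := 2 * K ^ 2 / (L₁ ^ 2 * κ ^ 2)
  have hCQ : 0 ≤ CQ := by positivity
  set V : ℝ → ℝ := fun b => (1 / ‖f b - f a‖ ^ 2 - 1 / arclen f a b ^ 2) *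
      (‖deriv f a‖ * ‖deriv f b‖) with hV
  set H : ℝ → ℝ := fun b =>
    ⟪deriv f a, f b - f a⟫ / ‖f b - f a‖ ^ 2 - ‖deriv f a‖ / arclen f a b with hH
  have hVm : Measurable V := by
    have c0 := hf.continuous
    have c1 := hf.continuous_deriv
    refine Measurable.mul (Measurable.sub (Measurable.div measurable_const ?_)
      (Measurable.div measurable_const ?_)) ?_ <;>
    · refine Continuous.measurable ?_
      fun_prop
  have hga := (hf.norm_deriv_bounds a).2
  have hVb : ∀ b ∈ Set.Icc p (p + 1), |V b| ≤ CQ * (L₂ * L₂) := by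
    intro b hb
    by_cases hba : b = a
    · have e0 : arclen f a a = 0 := intervalIntegral.integral_same
      have : V b = 0 := by simp [hV, hba, e0]
      rw [this, abs_zero]
      positivity
    · rw [hV]
      simp only
      rw [abs_mul, abs_of_nonneg (by positivity : 0 ≤ ‖deriv f a‖ * ‖deriv f b‖)]
      gcongr
      · exact hf.inv_sq_sub_inv_sq_bounds hκ hba (hκb b hb)
      · exact (hf.norm_deriv_bounds b).2
  have hVi : IntervalIntegrable V volume p (p + 1) := by
    refine (intervalIntegrable_const (c := CQ * (L₂ * L₂))).mono_fun' hVm.aestronglyMeasurable ?_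
    rw [Set.uIoc_of_le (by linarith)]
    exact (ae_restrict_iff' measurableSet_Ioc).2
      (Filter.Eventually.of_forall fun b hb => hVb b (Set.Ioc_subset_Icc_self hb))
  have hFi := hf.intervalIntegrable_contDensity a p (p + 1)
  have hHa : H a = 0 := by simp [hH, show arclen f a a = 0 from intervalIntegral.integral_same]
  have hHb : ∀ b ∈ Set.Icc p (p + 1), |H b| ≤ (K ^ 2 / κ ^ 2 + L₂ * L₂ * CQ) * |b - a| := by
    intro b hb
    by_cases hba : b = a
    · rw [hba, hHa]; simp
    · have hs : 0 < |b - a| := abs_pos.2 (sub_ne_zero.2 hba)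
      obtain ⟨n1, n2⟩ := hne b hb hba
      have n1' : ‖f b - f a‖ ≠ 0 := norm_ne_zero_iff.2 n1
      have e : H b = -(‖deriv f a‖ * arclen f a b - ⟪deriv f a, f b - f a⟫) / ‖f b - f a‖ ^ 2 +
          ‖deriv f a‖ * arclen f a b * (1 / ‖f b - f a‖ ^ 2 - 1 / arclen f a b ^ 2) := by
        rw [hH]
        field_simp
        ring
      rw [e]
      refine (abs_add_le _ _).trans ?_
      rw [abs_div, abs_neg, abs_mul, abs_mul, abs_norm,
        abs_of_nonneg (by positivity : 0 ≤ ‖f b - f a‖ ^ 2)]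
      calc _ ≤ K ^ 2 * |b - a| ^ 3 / (κ * |b - a|) ^ 2 + L₂ * (L₂ * |b - a|) * CQ := by
            gcongr
            · exact hf.abs_arclen_sub_inner_le a b
            · exact hκb b hb
            · exact (hf.abs_arclen_bounds a b).2
            · exact hf.inv_sq_sub_inv_sq_bounds hκ hba (hκb b hb)
        _ = _ := by field_simp
  have hderiv : ∀ b ∈ Set.Icc p (p + 1), b ≠ a → HasDerivAt H (contDensity f a b - V b) b :=
    fun b hb hba => hf.hasDerivAt_inner_div_sub (hne b hb hba).1 (hne b hb hba).2
  have hcont : ContinuousOn H (Set.Icc p (p + 1)) := by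
    intro b hb
    by_cases hba : b = a
    · subst hba
      rw [ContinuousWithinAt, hHa]
      refine squeeze_zero_norm' (a := fun x => (K ^ 2 / κ ^ 2 + L₂ * L₂ * CQ) * |x - b|) ?_ ?_
      · exact eventually_nhdsWithin_of_forall hHb
      · have : Continuous fun x => (K ^ 2 / κ ^ 2 + L₂ * L₂ * CQ) * |x - b| := by fun_prop
        have h := this.tendsto b
        rw [sub_self, abs_zero, mul_zero] at h
        exact h.mono_left nhdsWithin_le_nhds
    · exact (hderiv b hb hba).continuousAt.continuousWithinAt
  have ftc := integral_eq_of_hasDerivAt_off_countable_of_le H (fun b => contDensity f a b - V b)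
    (show p ≤ p + 1 by linarith) (Set.countable_singleton a) hcont
    (fun x hx => hderiv x (Set.Ioo_subset_Icc_self hx.1) hx.2) (hFi.sub hVi)
  rw [intervalIntegral.integral_sub hFi hVi] at ftc
  have e : H (p + 1) - H p = -(4 * ‖deriv f a‖ / arclen f 0 1) := by
    simp only [hH, h1, h2, hf.periodic]
    field_simp
    ring
  rw [e] at ftc
  linarith

lemma intrDist_add_fract (hf : BiLipschitzLoop f K L₁ L₂) {a b : ℝ} (h : |b - a| < 1) :
    intrDist f a (a + Int.fract (b - a)) = intrDist f a b := by
  rw [abs_lt] at h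
  rcases le_or_gt a b with hab | hab
  · rw [Int.fract_eq_self.2 ⟨by linarith, by linarith⟩, add_sub_cancel]
  · have e : Int.fract (b - a) = b - a + 1 := by
      rw [← Int.fract_add_one, Int.fract_eq_self.2 ⟨by linarith, by linarith⟩]
    have e1 : a + Int.fract (b - a) = b + 1 := by rw [e]; ring
    have h1 := hf.arclen_add a b (b + 1)
    rw [hf.arclen_add_one] at h1
    have h2 := (hf.arclen_bounds hab.le).1
    have h3 := (hf.arclen_bounds (show a ≤ b + 1 by linarith)).1
    have h4 := mul_pos hf.pos (sub_pos.2 hab)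
    have h5 : 0 ≤ L₁ * (b + 1 - a) := mul_nonneg hf.pos.le (by linarith)
    rw [arclen_symm] at h2
    rw [e1]
    change min |arclen f a (b + 1)| (arclen f 0 1 - |arclen f a (b + 1)|) =
      min |arclen f a b| (arclen f 0 1 - |arclen f a b|)
    rw [abs_of_nonneg (by linarith), abs_of_neg (by linarith), ← h1, min_comm]
    congr 1 <;> ring

lemma integral_mobiusDensity (hf : BiLipschitzLoop f K L₁ L₂) {a : ℝ} (ha : a ∈ Set.Ioc (0 : ℝ) 1) :
    ∫ b in (0 : ℝ)..1, mobiusDensity f a b =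
      (∫ b in (0 : ℝ)..1, contDensity f a b) + 4 * ‖deriv f a‖ / arclen f 0 1 := by
  obtain ⟨p, hp, hp', h1, h2⟩ := hf.exists_arclen_eq_half a
  set W : ℝ → ℝ := fun b => (1 / ‖f a - f b‖ ^ 2 -
    1 / intrDist f a (a + Int.fract (b - a)) ^ 2) * (‖deriv f a‖ * ‖deriv f b‖) with hW
  have hWper : Function.Periodic W 1 := fun b => by
    have : b + 1 - a = b - a + 1 := by ring
    simp only [hW, hf.periodic, hf.deriv_add_one, this, Int.fract_add_one]
  have hFper : Function.Periodic (contDensity f a) 1 := hf.contDensity_add_one a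
  have e1 : ∫ b in (0 : ℝ)..1, mobiusDensity f a b = ∫ b in (0 : ℝ)..1, W b := by
    refine intervalIntegral.integral_congr_ae (Filter.Eventually.of_forall fun b hb => ?_)
    rw [Set.uIoc_of_le zero_le_one] at hb
    simp only [hW, mobiusDensity]
    rw [hf.intrDist_add_fract (abs_lt.2 ⟨by linarith [hb.1, ha.2], by linarith [hb.2, ha.1]⟩)]
  have e2 := hWper.intervalIntegral_add_eq 0 p
  have e3 := hFper.intervalIntegral_add_eq 0 p
  rw [zero_add] at e2 e3
  rw [e1, e2, e3, ← hf.integral_contDensity_sub hp hp' h1 h2]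
  refine intervalIntegral.integral_congr fun b hb => ?_
  rw [Set.uIcc_of_le (by linarith)] at hb
  have hS := hf.abs_arclen_le_half h1 h2 hb
  have e4 : intrDist f a b = |arclen f a b| := by
    change min |arclen f a b| (arclen f 0 1 - |arclen f a b|) = _
    exact min_eq_left (by linarith)
  simp only [hW]
  rw [hf.intrDist_add_fract (abs_lt.2 ⟨by linarith [hb.1], by linarith [hb.2]⟩), e4, sq_abs,
    norm_sub_rev]

theorem integral_contDensity_eq (hf : BiLipschitzLoop f K L₁ L₂) :
    ∫ a in (0 : ℝ)..1, ∫ b in (0 : ℝ)..1, contDensity f a b = mobiusEnergy f - 4 := by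
  have hT : 0 < arclen f 0 1 := by linarith [(hf.arclen_bounds (zero_le_one)).1, hf.pos]
  have e : mobiusEnergy f = ∫ a in (0 : ℝ)..1,
      ((∫ b in (0 : ℝ)..1, contDensity f a b) + 4 / arclen f 0 1 * ‖deriv f a‖) := by
    refine intervalIntegral.integral_congr_ae (Filter.Eventually.of_forall fun a ha => ?_)
    rw [Set.uIoc_of_le zero_le_one] at ha
    exact (hf.integral_mobiusDensity ha).trans (by ring)
  rw [e, intervalIntegral.integral_add (hf.intervalIntegrable_integral_contDensity zero_le_one 0 1)
    ((hf.intervalIntegrable_norm_deriv 0 1).const_mul _), intervalIntegral.integral_const_mul]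
  change _ = _ + 4 / arclen f 0 1 * arclen f 0 1 - 4
  field_simp
  ring

end BiLipschitzLoop

end

/-- The principal part `P_{ij}` of the discrete Möbius energy density sums to
`E(f) − 4`, and the remainder `R_{ij} = M_{ij} − P_{ij}` sums to `0`, in the
limit `m → ∞`. -/
theorem discreteP_tendsto_E_and_R_tendsto_zero (n : ℕ)
    (f : ℝ → EuclideanSpace ℝ (Fin n))
    (hf_per : ∀ x : ℝ, f (x + 1) = f x)
    (hC1 : ContDiff ℝ 1 f)
    (Kf : NNReal) (hlip : LipschitzWith Kf (deriv f))
    (L₁ L₂ : ℝ) (hL₁ : 0 < L₁) (hL₁₂ : L₁ ≤ L₂)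
    (hbl : ∀ a b : ℝ,
      L₁ * circleDist a b ≤ ‖f a - f b‖ ∧ ‖f a - f b‖ ≤ L₂ * circleDist a b)
    (θ : ℕ → ℤ → ℝ)
    (hmono : ∀ m : ℕ, 1 ≤ m → StrictMono (θ m))
    (hθper : ∀ m : ℕ, 1 ≤ m → ∀ i : ℤ, θ m (i + m) = θ m i + 1)
    (hθ0 : ∀ m : ℕ, 1 ≤ m → 0 ≤ θ m 1)
    (hθ1 : ∀ m : ℕ, 1 ≤ m → θ m (m : ℤ) < 1)
    (Lm : ℕ → ℝ)
    (hLm : ∀ m : ℕ, Lm m = ∑ i ∈ Finset.Icc (1 : ℤ) (m : ℤ), ‖edge f (θ m) i‖)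
    (heq : ∀ m : ℕ, 1 ≤ m → ∀ i : ℤ, ‖edge f (θ m) i‖ = Lm m / m)
 :
    Filter.Tendsto
      (fun m : ℕ => discSum m (fun i j =>
        ((‖edge f (θ m) i‖ * ‖edge f (θ m) j‖) / chn f (θ m) i j ^ 2) *
          (1 - (1 / (2 * (‖edge f (θ m) i‖ * ‖edge f (θ m) j‖))) *
            (dOpI (dOpJ (fun a b => chn f (θ m) a b ^ 2)) i j +
              4 * (⟪chord f (θ m) i j, edge f (θ m) i⟫ *
                    ⟪chord f (θ m) i j, edge f (θ m) j⟫) / chn f (θ m) i j ^ 2))))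
      Filter.atTop (nhds (mobiusEnergy f - 4)) ∧
    Filter.Tendsto
      (fun m : ℕ => discSum m (fun i j =>
        ((1 / crossRatio f (θ m) i j) *
          (1 - (1 / 2) * dOpI (dOpJ (crossRatio f (θ m))) i j +
            (1 / (2 * crossRatio f (θ m) i j)) *
              (dOpI (crossRatio f (θ m)) i j * dOpJ (crossRatio f (θ m)) i j - 1))) -
        ((‖edge f (θ m) i‖ * ‖edge f (θ m) j‖) / chn f (θ m) i j ^ 2) *
          (1 - (1 / (2 * (‖edge f (θ m) i‖ * ‖edge f (θ m) j‖))) *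
            (dOpI (dOpJ (fun a b => chn f (θ m) a b ^ 2)) i j +
              4 * (⟪chord f (θ m) i j, edge f (θ m) i⟫ *
                    ⟪chord f (θ m) i j, edge f (θ m) j⟫) / chn f (θ m) i j ^ 2))))
      Filter.atTop (nhds 0) := by
  have hf : BiLipschitzLoop f Kf L₁ L₂ :=
    { periodic := hf_per
      hasDerivAt := fun x => (hC1.differentiable one_ne_zero x).hasDerivAt
      nonneg := Kf.2
      lipschitz := fun x y => by
        have h := hlip.dist_le_mul x y
        rwa [dist_eq_norm, Real.dist_eq] at h
      pos := hL₁
      le := hL₁₂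
      lower := fun a b h h' => by
        rw [← circleDist_eq_min h h']
        exact (hbl b a).1
      upper := fun a b h h' => by
        rw [← circleDist_eq_min h h']
        exact (hbl b a).2 }
  have hθ : ∀ m, 1 ≤ m → EquilateralParam f (θ m) m (Lm m / m) := fun m hm =>
    ⟨hmono m hm, hθper m hm, heq m hm⟩
  obtain ⟨m₀, h₀, hm₀⟩ := exists_forall_lt_mul_sub_one L₂ hf.pos
  have hedge : ∀ m, m₀ ≤ m → ∀ i, ‖edge f (θ m) i‖ ≠ 0 := fun m hm i => by
    rw [heq m (h₀.trans hm)]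
    exact ((hθ m (h₀.trans hm)).pos hf (hm₀ m hm)).ne'
  refine ⟨?_, ?_⟩
  · rw [← hf.integral_contDensity_eq]
    refine (tendsto_discSum_discPrincipal hf hθ).congr' ?_
    filter_upwards [Filter.eventually_ge_atTop m₀] with m hm
    congr 1
    funext i j
    exact (discPrincipal_eq f (θ m) i j (hedge m hm i) (hedge m hm j)).symm
  · refine (tendsto_discSum_discMobius_sub_discPrincipal hf hθ).congr' ?_
    filter_upwards [Filter.eventually_ge_atTop m₀] with m hm
    congr 1
    funext i j
    rw [← discPrincipal_eq f (θ m) i j (hedge m hm i) (hedge m hm j)]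
    rfl

end
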